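/- arXiv:2311.07038 — 3 statements merged into one kernel-verified Lean document; each statement's English description precedes it below -/
import Mathlib

section
/- (Limit-Set Dichotomy for Recurrent Points) Assume (H1)-(H2). Let x, y ∈ R(Φ). Then either (i) a − b ∈ Int C for all a ∈ ω(x) and all b ∈ ω(y); or (ii) ω(x) ∪ ω(y) is unordered. -/
open Set Metric Filter Topology Pointwise

noncomputable section

abbrev Euc (n : ℕ) := EuclideanSpace ℝ (Fin n)

/-- `Φ` is a continuous flow on `ℝⁿ`. -/
def IsFlow {n : ℕ} (Φ : ℝ → Euc n → Euc n) : Prop :=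
  Continuous (fun p : ℝ × Euc n => Φ p.1 p.2) ∧
  (∀ x, Φ 0 x = x) ∧
  (∀ t s x, Φ t (Φ s x) = Φ (t + s) x)

/-- `Cp` is a closed, solid, salient convex cone. -/
def IsConeOrder {n : ℕ} (Cp : Set (Euc n)) : Prop :=
  IsClosed Cp ∧ (∀ x ∈ Cp, ∀ y ∈ Cp, x + y ∈ Cp) ∧
  (∀ α : ℝ, 0 < α → ∀ x ∈ Cp, α • x ∈ Cp) ∧
  (interior Cp).Nonempty ∧ Cp ∩ (-Cp) = {0}

/-- `x ≤ y` iff `y - x ∈ C⁺`. -/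
def coneLe {n : ℕ} (Cp : Set (Euc n)) (x y : Euc n) : Prop := y - x ∈ Cp

/-- `x < y` iff `y - x ∈ C⁺ \ {0}`. -/
def coneLt {n : ℕ} (Cp : Set (Euc n)) (x y : Euc n) : Prop := y - x ∈ Cp ∧ y ≠ x

/-- `x ≪ y` iff `y - x ∈ Int C⁺`. -/
def coneLL {n : ℕ} (Cp : Set (Euc n)) (x y : Euc n) : Prop := y - x ∈ interior Cp

/-- `S` is unordered: no two distinct points related by `≤`. -/
def Unordered {n : ℕ} (Cp : Set (Euc n)) (S : Set (Euc n)) : Prop :=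
  ∀ x ∈ S, ∀ y ∈ S, x ≠ y → ¬ coneLe Cp x y

/-- (H1): `Φ` is strongly competitive. -/
def StronglyCompetitive {n : ℕ} (Φ : ℝ → Euc n → Euc n) (Cp : Set (Euc n)) : Prop :=
  ∀ t : ℝ, 0 < t → ∀ x y : Euc n,
    (coneLe Cp (Φ t x) (Φ t y) → coneLe Cp x y) ∧
    (coneLt Cp (Φ t x) (Φ t y) → coneLL Cp x y)

/-- `D` is invariant under the flow. -/
def Invariant {n : ℕ} (Φ : ℝ → Euc n → Euc n) (D : Set (Euc n)) : Prop :=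
  ∀ t : ℝ, Φ t '' D = D

/-- (H2): `Γ` is a compact invariant attractor uniformly attracting all compact sets. -/
def Dissipative {n : ℕ} (Φ : ℝ → Euc n → Euc n) (Γ : Set (Euc n)) : Prop :=
  Γ.Nonempty ∧ IsCompact Γ ∧ Invariant Φ Γ ∧
  ∀ N : Set (Euc n), IsCompact N → ∀ ε > 0, ∃ T : ℝ, ∀ t ≥ T, ∀ x ∈ N,
    Metric.infDist (Φ t x) Γ < ε

/-- The ω-limit set of `x`. -/
def omegaSet {n : ℕ} (Φ : ℝ → Euc n → Euc n) (x : Euc n) : Set (Euc n) :=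
  ⋂ t ∈ Ici (0 : ℝ), closure ((fun τ => Φ τ x) '' Ici t)

/-- The α-limit set of `x`. -/
def alphaSet {n : ℕ} (Φ : ℝ → Euc n → Euc n) (x : Euc n) : Set (Euc n) :=
  ⋂ t ∈ Iic (0 : ℝ), closure ((fun τ => Φ τ x) '' Iic t)

/-- The set `R(Φ)` of recurrent points. -/
def recurrentSet {n : ℕ} (Φ : ℝ → Euc n → Euc n) : Set (Euc n) :=
  {x | x ∈ omegaSet Φ x}

/-- The Birkhoff center `𝓑(Φ)`. -/
def birkhoffCenter {n : ℕ} (Φ : ℝ → Euc n → Euc n) : Set (Euc n) :=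
  closure (recurrentSet Φ)

/-- The set `E` of equilibria. -/
def equilibria {n : ℕ} (Φ : ℝ → Euc n → Euc n) : Set (Euc n) :=
  {p | ∀ t : ℝ, Φ t p = p}

/-- `C = C⁺ ∪ (−C⁺)`. -/
def coneC {n : ℕ} (Cp : Set (Euc n)) : Set (Euc n) := Cp ∪ (-Cp)

/-- `K = closure(ℝⁿ \ C)`. -/
def coneK {n : ℕ} (Cp : Set (Euc n)) : Set (Euc n) := closure ((coneC Cp)ᶜ)

/-- The translated cone `C_x = x + C`. -/
def coneCAt {n : ℕ} (Cp : Set (Euc n)) (x : Euc n) : Set (Euc n) := {y | y - x ∈ coneC Cp}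

/-- The translated complementary cone `K_x = x + K`. -/
def coneKAt {n : ℕ} (Cp : Set (Euc n)) (x : Euc n) : Set (Euc n) := {y | y - x ∈ coneK Cp}

/-- Strongly below and distinct; the distinctness only matters in dimension zero. -/
def StrictBelow {n : ℕ} (Cp : Set (Euc n)) (a b : Euc n) : Prop :=
  b - a ∈ interior Cp ∧ a ≠ b

/-- A flow that strongly preserves the order of a cone in forward time. -/
structure IsStronglyMonotoneFlow {n : ℕ} (Ψ : ℝ → Euc n → Euc n) (Cp : Set (Euc n)) : Prop where
  flow : IsFlow Ψ
  cone : IsConeOrder Cp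
  strictBelow : ∀ t : ℝ, 0 < t → ∀ a b, coneLe Cp a b → a ≠ b → StrictBelow Cp (Ψ t a) (Ψ t b)

/-- `X` is a compact invariant set in which the forward orbit of `z ∈ X` accumulates everywhere. -/
structure IsTransitiveAt {n : ℕ} (Ψ : ℝ → Euc n → Euc n) (X : Set (Euc n)) (z : Euc n) :
    Prop where
  isCompact : IsCompact X
  mapsTo : ∀ t, ∀ a ∈ X, Ψ t a ∈ X
  mem : z ∈ X
  mapClusterPt : ∀ a ∈ X, MapClusterPt a atTop (fun t => Ψ t z)

section Cone

variable {n : ℕ} {Cp : Set (Euc n)}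

theorem IsConeOrder.le_refl (hC : IsConeOrder Cp) (a : Euc n) : coneLe Cp a a := by
  have h : (0 : Euc n) ∈ Cp ∩ (-Cp) := by rw [hC.2.2.2.2]; rfl
  simpa [coneLe] using h.1

theorem IsConeOrder.le_trans (hC : IsConeOrder Cp) {a b c : Euc n} (hab : coneLe Cp a b)
    (hbc : coneLe Cp b c) : coneLe Cp a c := by
  have h := hC.2.1 _ hab _ hbc
  rwa [add_comm, sub_add_sub_cancel] at h

theorem IsConeOrder.le_antisymm (hC : IsConeOrder Cp) {a b : Euc n} (hab : coneLe Cp a b)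
    (hba : coneLe Cp b a) : a = b := by
  have h : b - a ∈ Cp ∩ (-Cp) := ⟨hab, by simpa [coneLe] using hba⟩
  rw [hC.2.2.2.2] at h
  exact (sub_eq_zero.1 h).symm

theorem IsConeOrder.isClosed_le (hC : IsConeOrder Cp) :
    IsClosed {p : Euc n × Euc n | coneLe Cp p.1 p.2} :=
  hC.1.preimage (continuous_snd.sub continuous_fst)

theorem IsConeOrder.le_of_tendsto (hC : IsConeOrder Cp) {ι : Type*} {l : Filter ι} [l.NeBot]
    {f g : ι → Euc n} {a b : Euc n} (hf : Tendsto f l (𝓝 a)) (hg : Tendsto g l (𝓝 b))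
    (h : ∀ᶠ i in l, coneLe Cp (f i) (g i)) : coneLe Cp a b :=
  hC.isClosed_le.mem_of_tendsto (hf.prodMk_nhds hg) h

theorem StrictBelow.le {a b : Euc n} (h : StrictBelow Cp a b) : coneLe Cp a b :=
  interior_subset h.1

theorem isOpen_strictBelow (Cp : Set (Euc n)) :
    IsOpen {p : Euc n × Euc n | StrictBelow Cp p.1 p.2} :=
  (isOpen_interior.preimage (continuous_snd.sub continuous_fst)).inter
    (isOpen_ne_fun continuous_fst continuous_snd)

end Cone

section Flow

variable {n : ℕ} {Ψ : ℝ → Euc n → Euc n}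

theorem IsFlow.continuous_apply (hΨ : IsFlow Ψ) (t : ℝ) : Continuous (Ψ t) :=
  hΨ.1.comp (continuous_const.prodMk continuous_id)

theorem IsFlow.continuous_orbit (hΨ : IsFlow Ψ) (a : Euc n) : Continuous (fun t => Ψ t a) :=
  hΨ.1.comp (continuous_id.prodMk continuous_const)

theorem IsFlow.apply_neg_apply (hΨ : IsFlow Ψ) (t : ℝ) (a : Euc n) : Ψ t (Ψ (-t) a) = a := by
  rw [hΨ.2.2, add_neg_cancel, hΨ.2.1]

theorem IsFlow.injective (hΨ : IsFlow Ψ) (t : ℝ) : Function.Injective (Ψ t) := by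
  intro a b h
  have h' := congrArg (Ψ (-t)) h
  simpa [hΨ.2.2, hΨ.2.1] using h'

theorem IsFlow.neg (hΨ : IsFlow Ψ) : IsFlow (fun t => Ψ (-t)) := by
  refine ⟨hΨ.1.comp (continuous_fst.neg.prodMk continuous_snd), fun a => ?_, fun t s a => ?_⟩
  · simp [hΨ.2.1]
  · simp only [hΨ.2.2]
    congr 1
    ring

end Flow

section Monotone

variable {n : ℕ} {Ψ : ℝ → Euc n → Euc n} {Cp X Y : Set (Euc n)} {z w : Euc n}

theorem IsStronglyMonotoneFlow.le (h : IsStronglyMonotoneFlow Ψ Cp) {t : ℝ} (ht : 0 ≤ t)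
    {a b : Euc n} (hab : coneLe Cp a b) : coneLe Cp (Ψ t a) (Ψ t b) := by
  rcases ht.eq_or_lt with rfl | ht
  · rwa [h.flow.2.1, h.flow.2.1]
  · by_cases hne : a = b
    · rw [hne]
      exact h.cone.le_refl _
    · exact (h.strictBelow t ht a b hab hne).le

theorem IsTransitiveAt.exists_ge_mem (hX : IsTransitiveAt Ψ X z) {a : Euc n} (ha : a ∈ X)
    {U : Set (Euc n)} (hU : U ∈ 𝓝 a) (T : ℝ) : ∃ t ≥ T, Ψ t z ∈ U :=
  (frequently_atTop.1 ((hX.mapClusterPt a ha).frequently hU)) T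

theorem IsTransitiveAt.exists_ultrafilter (hX : IsTransitiveAt Ψ X z) {a : Euc n} (ha : a ∈ X) :
    ∃ U : Ultrafilter ℝ, (U : Filter ℝ) ≤ atTop ∧ Tendsto (fun t => Ψ t z) U (𝓝 a) :=
  mapClusterPt_iff_ultrafilter.1 (hX.mapClusterPt a ha)

theorem exists_tendsto_ultrafilter {ι α : Type*} [TopologicalSpace α] {K : Set α}
    (hK : IsCompact K) (U : Ultrafilter ι) {f : ι → α} (hf : ∀ i, f i ∈ K) :
    ∃ p ∈ K, Tendsto f U (𝓝 p) :=
  hK.ultrafilter_le_nhds (U.map f) (by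
    rw [Filter.le_principal_iff]
    exact Filter.mem_map.2 (Filter.univ_mem' hf))

/-- The forward orbit of a point that is moved up by time `T` accumulates only at points that
are periodic with period `T`. -/
theorem IsStronglyMonotoneFlow.apply_eq_of_mapClusterPt (h : IsStronglyMonotoneFlow Ψ Cp)
    (hK : IsCompact X) (hX : ∀ t, Ψ t z ∈ X) {T : ℝ} (hT : 0 < T)
    (hle : coneLe Cp z (Ψ T z)) {a : Euc n} (ha : MapClusterPt a atTop (fun t => Ψ t z)) :
    Ψ T a = a := by
  set c : ℕ → Euc n := fun k => Ψ (k * T) z with hc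
  have hstep : ∀ k, coneLe Cp (c k) (c (k + 1)) := fun k => by
    have := h.le (t := k * T) (by positivity) hle
    rw [h.flow.2.2] at this
    simpa [hc, add_mul] using this
  have hmono : ∀ k m, k ≤ m → coneLe Cp (c k) (c m) := fun k m hkm => by
    induction m, hkm using Nat.le_induction with
    | base => exact h.cone.le_refl _
    | succ m _ ih => exact h.cone.le_trans ih (hstep m)
  have hub : ∀ p, MapClusterPt p atTop c → ∀ k, coneLe Cp (c k) p := fun p hp k => by
    obtain ⟨U, hU, hUp⟩ := mapClusterPt_iff_ultrafilter.1 hp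
    exact h.cone.le_of_tendsto tendsto_const_nhds hUp
      (((eventually_ge_atTop k).filter_mono hU).mono fun m hm => hmono k m hm)
  have hle' : ∀ p q, MapClusterPt p atTop c → MapClusterPt q atTop c → coneLe Cp p q :=
    fun p q hp hq => by
      obtain ⟨U, hU, hUp⟩ := mapClusterPt_iff_ultrafilter.1 hp
      exact h.cone.le_of_tendsto hUp tendsto_const_nhds (Eventually.of_forall (hub q hq))
  obtain ⟨p, -, hp⟩ := hK.exists_mapClusterPt (f := atTop) (u := c)
    (Filter.le_principal_iff.2 (Filter.mem_map.2 (Filter.univ_mem' fun k => hX _)))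
  have hlim : Tendsto c atTop (𝓝 p) :=
    hK.tendsto_nhds_of_unique_mapClusterPt (Eventually.of_forall fun k => hX _)
      fun q _ hq => h.cone.le_antisymm (hle' q p hq hp) (hle' p q hp hq)
  have hper : Ψ T p = p := by
    refine tendsto_nhds_unique (((h.flow.continuous_apply T).tendsto p).comp hlim) ?_
    refine (hlim.comp (tendsto_add_atTop_nat 1)).congr fun k => ?_
    simp only [hc, Function.comp, h.flow.2.2]
    congr 1
    push_cast
    ring
  obtain ⟨U, hU, hUa⟩ := mapClusterPt_iff_ultrafilter.1 ha
  obtain ⟨r, -, hr⟩ := exists_tendsto_ultrafilter (isCompact_Icc (a := 0) (b := T)) U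
    (f := fun t : ℝ => T * Int.fract (t / T)) fun t =>
      ⟨mul_nonneg hT.le (Int.fract_nonneg _),
        mul_le_of_le_one_right hT.le (Int.fract_lt_one _).le⟩
  have hfloor : Tendsto (fun t : ℝ => ⌊t / T⌋₊) U atTop :=
    (tendsto_nat_floor_atTop.comp (tendsto_id.atTop_div_const hT)).mono_left hU
  have hUa' : Tendsto (fun t => Ψ t z) U (𝓝 (Ψ r p)) := by
    refine ((h.flow.1.tendsto (r, p)).comp (hr.prodMk_nhds (hlim.comp hfloor))).congr' ?_
    filter_upwards [(eventually_ge_atTop 0).filter_mono hU] with t ht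
    simp only [hc, Function.comp, h.flow.2.2]
    congr 1
    rw [natCast_floor_eq_intCast_floor (div_nonneg ht hT.le), mul_comm _ T, ← mul_add,
      Int.fract_add_floor, mul_div_cancel₀ _ hT.ne']
  rw [tendsto_nhds_unique hUa hUa', h.flow.2.2, add_comm, ← h.flow.2.2, hper]

theorem IsStronglyMonotoneFlow.exists_strictBelow (h : IsStronglyMonotoneFlow Ψ Cp)
    (hX : IsTransitiveAt Ψ X z) (hY : IsTransitiveAt Ψ Y w) {a b : Euc n} (ha : a ∈ X)
    (hb : b ∈ Y) (hab : coneLe Cp a b) (hne : a ≠ b) :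
    ∃ s r, s < r ∧ StrictBelow Cp (Ψ s z) (Ψ r w) := by
  have hlt := h.strictBelow 1 one_pos a b hab hne
  obtain ⟨U, hU, V, hV, hUV⟩ := mem_nhds_prod_iff.1 ((isOpen_strictBelow Cp).mem_nhds
    (show (Ψ 1 a, Ψ 1 b) ∈ {p : Euc n × Euc n | StrictBelow Cp p.1 p.2} from hlt))
  obtain ⟨s, -, hs⟩ := hX.exists_ge_mem (hX.mapsTo 1 a ha) hU 0
  obtain ⟨r, hr, hr'⟩ := hY.exists_ge_mem (hY.mapsTo 1 b hb) hV (s + 1)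
  exact ⟨s, r, by linarith, hUV (Set.mk_mem_prod hs hr')⟩

theorem IsStronglyMonotoneFlow.eq_of_le (h : IsStronglyMonotoneFlow Ψ Cp)
    (hX : IsTransitiveAt Ψ X z) {a b : Euc n} (ha : a ∈ X) (hb : b ∈ X) (hab : coneLe Cp a b) :
    a = b := by
  by_contra hne
  obtain ⟨s, r, hsr, hlt⟩ := h.exists_strictBelow hX hX ha hb hab hne
  have hr : Ψ r z = Ψ (r - s) (Ψ s z) := by rw [h.flow.2.2, sub_add_cancel]
  rw [hr] at hlt
  refine hlt.2 (h.apply_eq_of_mapClusterPt hX.isCompact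
    (fun t => hX.mapsTo t _ (hX.mapsTo s z hX.mem)) (sub_pos.2 hsr) hlt.le ?_).symm
  obtain ⟨U, hU, hUz⟩ := hX.exists_ultrafilter hX.mem
  refine mapClusterPt_iff_ultrafilter.2 ⟨U, hU, ?_⟩
  refine (((h.flow.continuous_apply s).tendsto z).comp hUz).congr fun t => ?_
  simp only [Function.comp, h.flow.2.2, add_comm]

/-- Order relations between two transitive sets persist under arbitrary time shifts. -/
theorem IsStronglyMonotoneFlow.le_shift (h : IsStronglyMonotoneFlow Ψ Cp)
    (hX : IsTransitiveAt Ψ X z) (hY : IsTransitiveAt Ψ Y w) (hXY : X ≠ Y) {a b : Euc n}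
    (ha : a ∈ X) (hb : b ∈ Y) (hab : coneLe Cp a b) (hne : a ≠ b) {U : Ultrafilter ℝ}
    (hU : (U : Filter ℝ) ≤ atTop) {q p : Euc n} (hq : Tendsto (fun t => Ψ t z) U (𝓝 q))
    (hp : Tendsto (fun t => Ψ t w) U (𝓝 p)) (d : ℝ) : coneLe Cp q (Ψ d p) := by
  set I : Set ℝ := {d | ∃ t, StrictBelow Cp (Ψ t z) (Ψ (d + t) w)} with hI
  have hlim : ∀ d ∈ I, ∀ (U : Ultrafilter ℝ) (q p : Euc n), (U : Filter ℝ) ≤ atTop →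
      Tendsto (fun t => Ψ t z) U (𝓝 q) → Tendsto (fun t => Ψ t w) U (𝓝 p) →
      coneLe Cp q (Ψ d p) := by
    rintro d ⟨t, ht⟩ U q p hU hq hp
    refine h.cone.le_of_tendsto hq (((h.flow.continuous_apply d).tendsto p).comp hp) ?_
    filter_upwards [(eventually_ge_atTop t).filter_mono hU] with u hu
    have := h.le (sub_nonneg.2 hu) ht.le
    simp only [h.flow.2.2] at this
    simp only [Function.comp, h.flow.2.2]
    convert this using 2 <;> ring
  have hopen : IsOpen I := by
    rw [hI, Set.ofPred_exists]
    refine isOpen_iUnion fun t => (isOpen_strictBelow Cp).preimage (continuous_const.prodMk ?_)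
    exact (h.flow.continuous_orbit w).comp (continuous_add_const t)
  obtain ⟨V, q₀, p₀, hV, hq₀, hp₀, hne₀⟩ : ∃ (V : Ultrafilter ℝ) (q₀ p₀ : Euc n),
      (V : Filter ℝ) ≤ atTop ∧ Tendsto (fun t => Ψ t z) V (𝓝 q₀) ∧
      Tendsto (fun t => Ψ t w) V (𝓝 p₀) ∧ ∀ d, q₀ ≠ Ψ d p₀ := by
    by_cases hsub : X ⊆ Y
    · obtain ⟨p₀, hp₀, hp₀'⟩ := Set.not_subset.1 fun hsub' => hXY (hsub.antisymm hsub')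
      obtain ⟨V, hV, hVp⟩ := hY.exists_ultrafilter hp₀
      obtain ⟨q₀, hq₀, hVq⟩ := exists_tendsto_ultrafilter hX.isCompact V
        fun t => hX.mapsTo t z hX.mem
      refine ⟨V, q₀, p₀, hV, hVq, hVp, fun d hd => hp₀' ?_⟩
      have := hX.mapsTo (-d) q₀ hq₀
      rwa [hd, h.flow.2.2, neg_add_cancel, h.flow.2.1] at this
    · obtain ⟨q₀, hq₀, hq₀'⟩ := Set.not_subset.1 hsub
      obtain ⟨V, hV, hVq⟩ := hX.exists_ultrafilter hq₀
      obtain ⟨p₀, hp₀, hVp⟩ := exists_tendsto_ultrafilter hY.isCompact V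
        fun t => hY.mapsTo t w hY.mem
      refine ⟨V, q₀, p₀, hV, hVq, hVp, fun d hd => hq₀' ?_⟩
      rw [hd]
      exact hY.mapsTo d p₀ hp₀
  have hclosed : IsClosed I := by
    refine isClosed_of_closure_subset fun d hd => ?_
    have hcl : IsClosed {d | coneLe Cp q₀ (Ψ d p₀)} :=
      h.cone.isClosed_le.preimage (continuous_const.prodMk (h.flow.continuous_orbit p₀))
    have hle : coneLe Cp q₀ (Ψ d p₀) :=
      closure_minimal (fun d hd => hlim d hd V q₀ p₀ hV hq₀ hp₀) hcl hd
    have hlt := h.strictBelow 1 one_pos _ _ hle (hne₀ d)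
    have htend := (((h.flow.continuous_apply 1).tendsto q₀).comp hq₀).prodMk_nhds
      (((h.flow.continuous_apply 1).tendsto _).comp
        (((h.flow.continuous_apply d).tendsto p₀).comp hp₀))
    obtain ⟨t, ht⟩ := (htend.eventually ((isOpen_strictBelow Cp).mem_nhds hlt)).exists
    refine ⟨1 + t, ?_⟩
    simp only [Function.comp, h.flow.2.2] at ht
    rwa [add_left_comm d 1 t]
  have huniv : I = Set.univ := by
    refine IsClopen.eq_univ ⟨hclosed, hopen⟩ ?_
    obtain ⟨s, r, -, hlt⟩ := h.exists_strictBelow hX hY ha hb hab hne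
    exact ⟨r - s, s, by rwa [sub_add_cancel]⟩
  exact hlim d (huniv ▸ Set.mem_univ d) U q p hU hq hp

/-- A transitive set having a point strictly below all of `Y` lies entirely below `Y`. -/
theorem IsStronglyMonotoneFlow.le_of_forall_lt (h : IsStronglyMonotoneFlow Ψ Cp)
    (hX : IsTransitiveAt Ψ X z) (hY : IsTransitiveAt Ψ Y w) {q : Euc n} (hq : q ∈ X)
    (hqY : ∀ b ∈ Y, coneLe Cp q b ∧ q ≠ b) {a b : Euc n} (ha : a ∈ X) (hb : b ∈ Y) :
    coneLe Cp a b := by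
  have hlt : ∀ b ∈ Y, StrictBelow Cp (Ψ 1 q) b := fun b hb => by
    have hb' := hqY _ (hY.mapsTo (-1) b hb)
    have := h.strictBelow 1 one_pos _ _ hb'.1 hb'.2
    rwa [h.flow.apply_neg_apply] at this
  have hnhds : ∀ᶠ u in 𝓝 (Ψ 1 q), ∀ b ∈ Y, StrictBelow Cp u b :=
    hY.isCompact.eventually_forall_of_forall_eventually fun b hb =>
      (isOpen_strictBelow Cp).mem_nhds (hlt b hb)
  obtain ⟨s, -, hs⟩ := hX.exists_ge_mem (hX.mapsTo 1 q hq) hnhds 0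
  obtain ⟨U, hU, hUa⟩ := hX.exists_ultrafilter ha
  refine h.cone.le_of_tendsto hUa tendsto_const_nhds ?_
  filter_upwards [(eventually_ge_atTop s).filter_mono hU] with t ht
  have := h.le (sub_nonneg.2 ht) (hs _ (hY.mapsTo (-(t - s)) b hb)).le
  rwa [h.flow.apply_neg_apply, h.flow.2.2, sub_add_cancel] at this

theorem IsStronglyMonotoneFlow.strictBelow_of_exists_lt (h : IsStronglyMonotoneFlow Ψ Cp)
    (hX : IsTransitiveAt Ψ X z) (hY : IsTransitiveAt Ψ Y w) {a₀ b₀ : Euc n}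
    (ha₀ : a₀ ∈ X) (hb₀ : b₀ ∈ Y) (hab : coneLe Cp a₀ b₀) (hne : a₀ ≠ b₀)
    {a b : Euc n} (ha : a ∈ X) (hb : b ∈ Y) : StrictBelow Cp a b := by
  have hXY : X ≠ Y := by
    rintro rfl
    exact hne (h.eq_of_le hX ha₀ hb₀ hab)
  obtain ⟨q, hq, hqY⟩ : ∃ q ∈ X, ∀ b ∈ Y, coneLe Cp q b := by
    obtain ⟨U, hU, hUw⟩ := hY.exists_ultrafilter hY.mem
    obtain ⟨q, hq, hUq⟩ := exists_tendsto_ultrafilter hX.isCompact U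
      fun t => hX.mapsTo t z hX.mem
    refine ⟨q, hq, fun b hb => ?_⟩
    obtain ⟨V, -, hVb⟩ := hY.exists_ultrafilter hb
    exact h.cone.le_of_tendsto tendsto_const_nhds hVb (Eventually.of_forall fun d =>
      h.le_shift hX hY hXY ha₀ hb₀ hab hne hU hUq hUw d)
  obtain ⟨p, hp, hpX⟩ : ∃ p ∈ Y, ∀ a ∈ X, coneLe Cp a p := by
    obtain ⟨U, hU, hUz⟩ := hX.exists_ultrafilter hX.mem
    obtain ⟨p, hp, hUp⟩ := exists_tendsto_ultrafilter hY.isCompact U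
      fun t => hY.mapsTo t w hY.mem
    refine ⟨p, hp, fun a ha => ?_⟩
    obtain ⟨V, hV, hVa⟩ := hX.exists_ultrafilter ha
    refine h.cone.le_of_tendsto hVa tendsto_const_nhds ?_
    filter_upwards [(eventually_ge_atTop 0).filter_mono hV] with t ht
    have := h.le ht (h.le_shift hX hY hXY ha₀ hb₀ hab hne hU hUz hUp (-t))
    rwa [h.flow.apply_neg_apply] at this
  have hle : ∀ a ∈ X, ∀ b ∈ Y, coneLe Cp a b := fun a ha b hb => by
    by_cases hqY' : q ∈ Y
    · rw [← h.eq_of_le hY hqY' hb (hqY b hb), h.eq_of_le hY hqY' hp (hqY p hp)]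
      exact hpX a ha
    · refine h.le_of_forall_lt hX hY hq (fun b hb => ⟨hqY b hb, ?_⟩) ha hb
      rintro rfl
      exact hqY' hb
  have ha' := hX.mapsTo (-1) a ha
  have hb' := hY.mapsTo (-1) b hb
  have hne' : Ψ (-1) a ≠ Ψ (-1) b := fun heq => by
    have hXe : ∀ c ∈ X, c = Ψ (-1) a := fun c hc =>
      h.eq_of_le hX hc ha' (heq ▸ hle c hc _ hb')
    have hYe : ∀ c ∈ Y, c = Ψ (-1) a := fun c hc =>
      heq ▸ (h.eq_of_le hY hb' hc (heq ▸ hle _ ha' c hc)).symm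
    exact hne ((hXe a₀ ha₀).trans (hYe b₀ hb₀).symm)
  have := h.strictBelow 1 one_pos _ _ (hle _ ha' _ hb') hne'
  rwa [h.flow.apply_neg_apply, h.flow.apply_neg_apply] at this

end Monotone

section OmegaLimit

variable {n : ℕ} {Φ : ℝ → Euc n → Euc n}

theorem mem_omegaSet_iff {x a : Euc n} :
    a ∈ omegaSet Φ x ↔ MapClusterPt a atTop (fun t => Φ t x) := by
  simp only [omegaSet, Set.mem_iInter₂, Set.mem_Ici, mapClusterPt_iff_frequently,
    frequently_atTop, mem_closure_iff_nhds]
  constructor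
  · intro h s hs T
    obtain ⟨_, hs', t, ht, rfl⟩ := h (max T 0) (le_max_right _ _) s hs
    exact ⟨t, (le_max_left _ _).trans ht, hs'⟩
  · intro h T _ s hs
    obtain ⟨t, ht, hts⟩ := h s hs T
    exact ⟨_, hts, t, ht, rfl⟩

theorem IsFlow.apply_mem_omegaSet (hΦ : IsFlow Φ) {x a : Euc n} (ha : a ∈ omegaSet Φ x) (t : ℝ) :
    Φ t a ∈ omegaSet Φ x := by
  rw [mem_omegaSet_iff, mapClusterPt_iff_ultrafilter] at ha
  obtain ⟨U, hU, hUa⟩ := ha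
  refine mem_omegaSet_iff.2 (MapClusterPt.of_comp (φ := fun s => t + s) (p := (U : Filter ℝ))
    ((tendsto_atTop_add_const_left atTop t tendsto_id).mono_left hU) ?_)
  refine Tendsto.mapClusterPt ?_
  refine (((hΦ.continuous_apply t).tendsto a).comp hUa).congr fun s => ?_
  simp only [Function.comp, hΦ.2.2]

theorem Dissipative.isCompact_omegaSet {Γ : Set (Euc n)} (hΓ : Dissipative Φ Γ) (x : Euc n) :
    IsCompact (omegaSet Φ x) := by
  obtain ⟨hne, hK, -, hatt⟩ := hΓ
  obtain ⟨T, hT⟩ := hatt {x} isCompact_singleton 1 one_pos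
  refine Metric.isCompact_of_isClosed_isBounded
    (isClosed_biInter fun t _ => isClosed_closure) ?_
  refine (hK.isBounded.thickening (δ := 1)).closure.subset fun a ha => ?_
  refine closure_mono ?_ (Set.mem_iInter₂.1 ha (max T 0) (le_max_right T 0))
  rintro _ ⟨t, ht, rfl⟩
  exact (Metric.mem_thickening_iff_infDist_lt hne).2
    (hT t ((le_max_left _ _).trans ht) x rfl)

/-- The limit set of a recurrent point contains a point whose backward orbit accumulates
everywhere in it. -/
theorem IsFlow.exists_isTransitiveAt_neg (hΦ : IsFlow Φ) {x : Euc n}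
    (hK : IsCompact (omegaSet Φ x)) (hx : x ∈ omegaSet Φ x) :
    ∃ z, IsTransitiveAt (fun t => Φ (-t)) (omegaSet Φ x) z := by
  set X := omegaSet Φ x with hX
  have : CompactSpace X := isCompact_iff_compactSpace.1 hK
  have : Nonempty X := ⟨⟨x, hx⟩⟩
  let f : ℝ → X → X := fun t a => ⟨Φ t a, hΦ.apply_mem_omegaSet a.2 t⟩
  have hf : ∀ t, Continuous (f t) := fun t =>
    ((hΦ.continuous_apply t).comp continuous_subtype_val).subtype_mk _
  have hvisit : ∀ V : Set X, IsOpen V → V.Nonempty → ∀ T : ℝ, ∃ t ≥ T, f t ⟨x, hx⟩ ∈ V := by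
    rintro V hV ⟨v, hv⟩ T
    obtain ⟨W, hW, rfl⟩ := isOpen_induced_iff.1 hV
    exact frequently_atTop.1
      ((mem_omegaSet_iff.1 v.2).frequently (hW.mem_nhds hv)) T
  let B := TopologicalSpace.countableBasis X
  let G : B × ℕ → Set X := fun i => ⋃ t ∈ Set.Ici (i.2 : ℝ), f (-t) ⁻¹' i.1
  have hBopen : ∀ V : B, IsOpen (V : Set X) := fun V =>
    (TopologicalSpace.isBasis_countableBasis X).isOpen V.2
  have hGopen : ∀ i, IsOpen (G i) := fun i =>
    isOpen_biUnion fun t _ => (hBopen i.1).preimage (hf _)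
  have hGdense : ∀ i, Dense (G i) := by
    rintro ⟨V, k⟩
    refine dense_iff_inter_open.2 fun W hW hWne => ?_
    obtain ⟨s, -, hs⟩ := hvisit V (hBopen V)
      (TopologicalSpace.nonempty_of_mem_countableBasis V.2) 0
    obtain ⟨r, hr, hr'⟩ := hvisit W hW hWne (s + k)
    refine ⟨f r ⟨x, hx⟩, hr', Set.mem_iUnion₂.2 ⟨r - s, ?_, ?_⟩⟩
    · simp only [Set.mem_Ici]
      linarith
    · have : f (-(r - s)) (f r ⟨x, hx⟩) = f s ⟨x, hx⟩ := by
        ext1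
        simp only [f, hΦ.2.2]
        congr 1
        ring
      rwa [Set.mem_preimage, this]
  obtain ⟨z, hz⟩ := (dense_iInter_of_isOpen hGopen hGdense).nonempty
  refine ⟨z, hK, fun t a ha => hΦ.apply_mem_omegaSet ha _, z.2, fun a ha => ?_⟩
  refine mapClusterPt_iff_frequently.2 fun s hs => frequently_atTop.2 fun T => ?_
  obtain ⟨k, hk⟩ := exists_nat_ge T
  obtain ⟨V, hVB, -, hVs⟩ := (TopologicalSpace.isBasis_countableBasis X).mem_nhds_iff.1
    (continuous_subtype_val.continuousAt.preimage_mem_nhds (x := (⟨a, ha⟩ : X)) hs)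
  obtain ⟨t, ht, htV⟩ := Set.mem_iUnion₂.1 (Set.mem_iInter.1 hz (⟨V, hVB⟩, k))
  exact ⟨t, hk.trans ht, hVs htV⟩

end OmegaLimit

theorem StronglyCompetitive.isStronglyMonotoneFlow {n : ℕ} {Φ : ℝ → Euc n → Euc n}
    {Cp : Set (Euc n)} (hcomp : StronglyCompetitive Φ Cp) (hΦ : IsFlow Φ) (hC : IsConeOrder Cp) :
    IsStronglyMonotoneFlow (fun t => Φ (-t)) Cp where
  flow := hΦ.neg
  cone := hC
  strictBelow t ht a b hab hne := by
    refine ⟨(hcomp t ht (Φ (-t) a) (Φ (-t) b)).2 ?_, (hΦ.injective _).ne hne⟩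
    rw [hΦ.apply_neg_apply, hΦ.apply_neg_apply]
    exact ⟨hab, hne.symm⟩

theorem StrictBelow.sub_mem_interior_coneC {n : ℕ} {Cp : Set (Euc n)} {a b : Euc n}
    (h : StrictBelow Cp a b) :
    a - b ∈ interior (coneC Cp) ∧ b - a ∈ interior (coneC Cp) := by
  refine ⟨interior_mono Set.subset_union_right ?_, interior_mono Set.subset_union_left h.1⟩
  refine mem_interior.2 ⟨-interior Cp, Set.neg_subset_neg.2 interior_subset,
    isOpen_interior.neg, ?_⟩
  simpa using h.1

theorem stmt7 {n : ℕ} (Φ : ℝ → Euc n → Euc n) (Cp Γ : Set (Euc n))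
    (hΦ : IsFlow Φ) (hC : IsConeOrder Cp) (hcomp : StronglyCompetitive Φ Cp)
    (hΓ : Dissipative Φ Γ)
    (x y : Euc n) (hx : x ∈ recurrentSet Φ) (hy : y ∈ recurrentSet Φ) :
    (∀ a ∈ omegaSet Φ x, ∀ b ∈ omegaSet Φ y, a - b ∈ interior (coneC Cp)) ∨
    Unordered Cp (omegaSet Φ x ∪ omegaSet Φ y) := by
  have h := hcomp.isStronglyMonotoneFlow hΦ hC
  obtain ⟨z, hz⟩ := hΦ.exists_isTransitiveAt_neg (hΓ.isCompact_omegaSet x) hx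
  obtain ⟨w, hw⟩ := hΦ.exists_isTransitiveAt_neg (hΓ.isCompact_omegaSet y) hy
  refine or_iff_not_imp_right.2 fun hnot => ?_
  simp only [Unordered, not_forall, not_not] at hnot
  obtain ⟨a₀, ha₀, b₀, hb₀, hne, hle⟩ := hnot
  intro a ha b hb
  rcases ha₀ with ha₀ | ha₀ <;> rcases hb₀ with hb₀ | hb₀
  · exact absurd (h.eq_of_le hz ha₀ hb₀ hle) hne
  · exact (h.strictBelow_of_exists_lt hz hw ha₀ hb₀ hle hne ha hb).sub_mem_interior_coneC.1
  · exact (h.strictBelow_of_exists_lt hw hz ha₀ hb₀ hle hne hb ha).sub_mem_interior_coneC.2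
  · exact absurd (h.eq_of_le hw ha₀ hb₀ hle) hne
end
end

section
/- (Connecting Lemma) Assume (H1)-(H2). Let S ⊂ 𝓑(Φ) be a connected set and let x ∈ R(Φ). If there exist b, c ∈ S with b ∈ Int C_x and c ∈ Int K_x, then x ∈ S. -/
open Set Metric Filter Topology Pointwise

noncomputable section

section Cone

variable {n : ℕ} {Cp : Set (Euc n)}

theorem IsConeOrder.add_mem_interior (hC : IsConeOrder Cp) {x y : Euc n}
    (hx : x ∈ interior Cp) (hy : y ∈ Cp) : x + y ∈ interior Cp := by
  have hopen : IsOpen ((fun z => z + y) '' interior Cp) :=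
    (Homeomorph.addRight y).isOpenMap _ isOpen_interior
  refine interior_maximal ?_ hopen ⟨x, hx, rfl⟩
  rintro _ ⟨z, hz, rfl⟩
  exact hC.2.1 z (interior_subset hz) y hy

theorem IsConeOrder.smul_mem_interior (hC : IsConeOrder Cp) {x : Euc n} {α : ℝ} (hα : 0 < α)
    (hx : x ∈ interior Cp) : α • x ∈ interior Cp := by
  have hopen : IsOpen ((fun z => α • z) '' interior Cp) :=
    (Homeomorph.smulOfNeZero α hα.ne').isOpenMap _ isOpen_interior
  refine interior_maximal ?_ hopen ⟨x, hx, rfl⟩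
  rintro _ ⟨z, hz, rfl⟩
  exact hC.2.2.1 α hα z (interior_subset hz)

/-- A proper cone does not contain the origin in its interior. -/
theorem IsConeOrder.zero_notMem_interior (hC : IsConeOrder Cp) {z : Euc n} (hz : z ∉ Cp) :
    (0 : Euc n) ∉ interior Cp := by
  intro h0
  have hlim : Tendsto (fun δ : ℝ => δ • z) (𝓝[>] 0) (𝓝 0) := by
    have : Continuous (fun δ : ℝ => δ • z) := by fun_prop
    simpa using (this.tendsto 0).mono_left nhdsWithin_le_nhds
  obtain ⟨δ, hδ, hδ0⟩ := ((hlim.eventually (mem_interior_iff_mem_nhds.1 h0)).and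
    self_mem_nhdsWithin).exists
  have hδ0 : 0 < δ := hδ0
  apply hz
  have := hC.2.2.1 δ⁻¹ (inv_pos.2 hδ0) _ hδ
  rwa [smul_smul, inv_mul_cancel₀ hδ0.ne', one_smul] at this

theorem IsConeOrder.mem_closure_interior (hC : IsConeOrder Cp) {x : Euc n} (hx : x ∈ Cp) :
    x ∈ closure (interior Cp) := by
  obtain ⟨e, he⟩ := hC.2.2.2.1
  have hlim : Tendsto (fun δ : ℝ => δ • e + x) (𝓝[>] 0) (𝓝 x) := by
    have : Continuous (fun δ : ℝ => δ • e + x) := by fun_prop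
    simpa using (this.tendsto 0).mono_left nhdsWithin_le_nhds
  refine mem_closure_of_tendsto hlim ?_
  filter_upwards [self_mem_nhdsWithin] with δ hδ
  exact hC.add_mem_interior (hC.smul_mem_interior hδ he) hx

theorem IsConeOrder.isClosed_coneC (hC : IsConeOrder Cp) : IsClosed (coneC Cp) :=
  hC.1.union hC.1.neg

theorem IsConeOrder.isClosed_coneCAt (hC : IsConeOrder Cp) (x : Euc n) :
    IsClosed (coneCAt Cp x) :=
  hC.isClosed_coneC.preimage (continuous_id.sub continuous_const)

theorem IsConeOrder.coneC_subset_closure_interior (hC : IsConeOrder Cp) :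
    coneC Cp ⊆ closure (interior (coneC Cp)) := by
  rintro z (hz | hz)
  · exact closure_mono (interior_mono subset_union_left) (hC.mem_closure_interior hz)
  · have h : z ∈ closure (-interior Cp) := by
      have := map_mem_closure continuous_neg (hC.mem_closure_interior hz)
        (t := -interior Cp) fun a ha => by simpa using ha
      rwa [neg_neg] at this
    refine closure_mono (interior_maximal ?_ isOpen_interior.neg) h
    exact (Set.neg_subset_neg.2 interior_subset).trans subset_union_right

theorem IsConeOrder.disjoint_interior_coneK (hC : IsConeOrder Cp) {z : Euc n}
    (hz : z ∈ interior (coneK Cp)) : z ∉ coneC Cp := by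
  intro hzC
  have h := hC.coneC_subset_closure_interior hzC
  have : (closure (interior (coneC Cp)))ᶜ = interior (coneK Cp) := by
    rw [coneK, closure_compl, ← interior_compl]
  exact (this ▸ hz) h

theorem IsConeOrder.notMem_coneCAt (hC : IsConeOrder Cp) {x c : Euc n}
    (hc : c ∈ interior (coneKAt Cp x)) : c ∉ coneCAt Cp x := by
  have h : interior (coneKAt Cp x) ⊆ (fun y => y - x) ⁻¹' interior (coneK Cp) := by
    have := (Homeomorph.subRight x).preimage_interior (coneK Cp)
    exact this.symm.subset
  exact hC.disjoint_interior_coneK (h hc)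

theorem isOpen_coneLL (Cp : Set (Euc n)) : IsOpen {p : Euc n × Euc n | coneLL Cp p.1 p.2} :=
  isOpen_interior.preimage (continuous_snd.sub continuous_fst)

theorem coneLL.eventually {ι : Type*} {l : Filter ι} {f g : ι → Euc n} {x y : Euc n}
    (h : coneLL Cp x y) (hf : Tendsto f l (𝓝 x)) (hg : Tendsto g l (𝓝 y)) :
    ∀ᶠ i in l, coneLL Cp (f i) (g i) :=
  (hf.prodMk_nhds hg).eventually ((isOpen_coneLL Cp).mem_nhds h)

theorem IsConeOrder.coneLe_of_tendsto (hC : IsConeOrder Cp) {ι : Type*} {l : Filter ι} [l.NeBot]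
    {f g : ι → Euc n} {x y : Euc n} (hf : Tendsto f l (𝓝 x)) (hg : Tendsto g l (𝓝 y))
    (h : ∀ᶠ i in l, coneLe Cp (f i) (g i)) : coneLe Cp x y :=
  hC.1.mem_of_tendsto (hg.sub hf) h

theorem coneLL.le {x y : Euc n} (h : coneLL Cp x y) : coneLe Cp x y := interior_subset h

theorem IsConeOrder.coneLL_trans (hC : IsConeOrder Cp) {x y z : Euc n}
    (h₁ : coneLL Cp x y) (h₂ : coneLL Cp y z) : coneLL Cp x z := by
  have := hC.add_mem_interior h₁ h₂.le
  rwa [sub_add_sub_comm, add_comm, add_sub_add_right_eq_sub] at this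

end Cone

section Flow

variable {n : ℕ} {Φ : ℝ → Euc n → Euc n} {Cp Γ : Set (Euc n)}

theorem IsFlow.tendsto (hΦ : IsFlow Φ) {ι : Type*} {l : Filter ι} {s : ι → ℝ} {f : ι → Euc n}
    {t : ℝ} {x : Euc n} (hs : Tendsto s l (𝓝 t)) (hf : Tendsto f l (𝓝 x)) :
    Tendsto (fun i => Φ (s i) (f i)) l (𝓝 (Φ t x)) :=
  (hΦ.1.tendsto (t, x)).comp (hs.prodMk_nhds hf)

theorem IsFlow.tendsto_const (hΦ : IsFlow Φ) {ι : Type*} {l : Filter ι} {f : ι → Euc n}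
    (t : ℝ) {x : Euc n} (hf : Tendsto f l (𝓝 x)) :
    Tendsto (fun i => Φ t (f i)) l (𝓝 (Φ t x)) :=
  hΦ.tendsto tendsto_const_nhds hf

theorem IsFlow.continuous_time (hΦ : IsFlow Φ) (x : Euc n) : Continuous (fun t => Φ t x) :=
  hΦ.1.comp (continuous_id.prodMk continuous_const)

theorem IsFlow.injective_s9 (hΦ : IsFlow Φ) (t : ℝ) : Function.Injective (Φ t) := by
  intro x y h
  have := congrArg (Φ (-t)) h
  simpa [hΦ.2.2, hΦ.2.1] using this

theorem IsFlow.coneLe_shift (hΦ : IsFlow Φ) (hcomp : StronglyCompetitive Φ Cp) {a b r : ℝ}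
    {p q : Euc n} (h : coneLe Cp (Φ a p) (Φ b q)) (hr : 0 ≤ r) :
    coneLe Cp (Φ (a - r) p) (Φ (b - r) q) := by
  rcases hr.eq_or_lt with rfl | hr
  · simpa using h
  · refine (hcomp r hr _ _).1 ?_
    simpa [hΦ.2.2] using h

theorem IsFlow.coneLL_shift_of_coneLe (hΦ : IsFlow Φ) (hcomp : StronglyCompetitive Φ Cp)
    {a b r : ℝ} {p q : Euc n} (h : coneLe Cp (Φ a p) (Φ b q)) (hne : Φ a p ≠ Φ b q)
    (hr : 0 < r) : coneLL Cp (Φ (a - r) p) (Φ (b - r) q) := by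
  refine (hcomp r hr _ _).2 ?_
  simpa [hΦ.2.2, coneLt, coneLe] using And.intro h hne.symm

theorem coneLL.ne (h0 : (0 : Euc n) ∉ interior Cp) {x y : Euc n} (h : coneLL Cp x y) :
    x ≠ y := by
  rintro rfl
  exact h0 (by simpa [coneLL] using h)

theorem IsFlow.coneLL_shift (hΦ : IsFlow Φ) (hcomp : StronglyCompetitive Φ Cp)
    (h0 : (0 : Euc n) ∉ interior Cp) {a b r : ℝ} {p q : Euc n}
    (h : coneLL Cp (Φ a p) (Φ b q)) (hr : 0 ≤ r) :
    coneLL Cp (Φ (a - r) p) (Φ (b - r) q) := by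
  rcases hr.eq_or_lt with rfl | hr
  · simpa using h
  · exact hΦ.coneLL_shift_of_coneLe hcomp h.le (h.ne h0) hr

theorem exists_seq_of_mem_omegaSet {x y : Euc n} (h : y ∈ omegaSet Φ x) :
    ∃ t : ℕ → ℝ, Tendsto t atTop atTop ∧ Tendsto (fun k => Φ (t k) x) atTop (𝓝 y) := by
  have key : ∀ k : ℕ, ∃ t : ℝ, (k : ℝ) ≤ t ∧ dist (Φ t x) y < 1 / ((k : ℝ) + 1) := by
    intro k
    have hk : y ∈ closure ((fun τ => Φ τ x) '' Ici (k : ℝ)) :=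
      mem_iInter₂.1 h (k : ℝ) (mem_Ici.2 k.cast_nonneg)
    obtain ⟨_, ⟨t, ht, rfl⟩, hd⟩ := Metric.mem_closure_iff.1 hk _ (Nat.one_div_pos_of_nat (n := k))
    exact ⟨t, ht, by rwa [dist_comm]⟩
  choose t ht hd using key
  refine ⟨t, tendsto_atTop_mono ht tendsto_natCast_atTop_atTop, ?_⟩
  rw [tendsto_iff_dist_tendsto_zero]
  exact squeeze_zero (fun _ => dist_nonneg) (fun k => (hd k).le)
    tendsto_one_div_add_atTop_nhds_zero_nat

theorem mem_omegaSet_of_tendsto {x y : Euc n} {t : ℕ → ℝ} (ht : Tendsto t atTop atTop)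
    (h : Tendsto (fun k => Φ (t k) x) atTop (𝓝 y)) : y ∈ omegaSet Φ x := by
  refine mem_iInter₂.2 fun s _ => mem_closure_of_tendsto h ?_
  filter_upwards [ht.eventually_ge_atTop s] with k hk
  exact ⟨t k, hk, rfl⟩

theorem isClosed_omegaSet (x : Euc n) : IsClosed (omegaSet Φ x) :=
  isClosed_biInter fun _ _ => isClosed_closure

theorem IsFlow.mem_recurrentSet (hΦ : IsFlow Φ) {x : Euc n} (hx : x ∈ recurrentSet Φ) (r : ℝ) :
    Φ r x ∈ recurrentSet Φ := by
  obtain ⟨t, ht, hlim⟩ := exists_seq_of_mem_omegaSet hx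
  refine mem_omegaSet_of_tendsto ht ?_
  have := hΦ.tendsto_const r hlim
  simpa only [hΦ.2.2, add_comm] using this

theorem IsFlow.closure_orbit_subset_omegaSet (hΦ : IsFlow Φ) {x : Euc n}
    (hx : x ∈ recurrentSet Φ) : closure (range fun t => Φ t x) ⊆ omegaSet Φ x := by
  refine closure_minimal ?_ (isClosed_omegaSet x)
  rintro _ ⟨r, rfl⟩
  obtain ⟨t, ht, hlim⟩ := exists_seq_of_mem_omegaSet hx
  refine mem_omegaSet_of_tendsto (tendsto_atTop_add_const_left atTop r ht) ?_
  simpa only [hΦ.2.2] using hΦ.tendsto_const r hlim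

theorem IsFlow.mem_closure_orbit (hΦ : IsFlow Φ) {x y : Euc n}
    (hy : y ∈ closure (range fun t => Φ t x)) (r : ℝ) :
    Φ r y ∈ closure (range fun t => Φ t x) := by
  refine map_mem_closure (hΦ.1.comp (continuous_const.prodMk continuous_id)) hy ?_
  rintro _ ⟨t, rfl⟩
  exact ⟨r + t, (hΦ.2.2 r t x).symm⟩

theorem Dissipative.omegaSet_subset (hΓ : Dissipative Φ Γ) (x : Euc n) :
    omegaSet Φ x ⊆ Γ := by
  intro y hy
  obtain ⟨t, ht, hlim⟩ := exists_seq_of_mem_omegaSet hy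
  rw [hΓ.2.1.isClosed.mem_iff_infDist_zero hΓ.1]
  have h1 : Tendsto (fun k => infDist (Φ (t k) x) Γ) atTop (𝓝 (infDist y Γ)) :=
    ((continuous_infDist_pt Γ).tendsto y).comp hlim
  refine le_antisymm (le_of_forall_pos_le_add fun ε hε => ?_) infDist_nonneg
  obtain ⟨T, hT⟩ := hΓ.2.2.2 {x} isCompact_singleton ε hε
  rw [zero_add]
  refine le_of_tendsto h1 ?_
  filter_upwards [ht.eventually_ge_atTop T] with k hk
  exact (hT _ hk x rfl).le

theorem Dissipative.apply_mem (hΓ : Dissipative Φ Γ) {x : Euc n} (hx : x ∈ Γ) (t : ℝ) :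
    Φ t x ∈ Γ :=
  (hΓ.2.2.1 t).subset (mem_image_of_mem _ hx)

/-- A recurrent point is not strongly below any point of its own orbit. -/
theorem not_coneLL_orbit (hΦ : IsFlow Φ) (hC : IsConeOrder Cp) (hcomp : StronglyCompetitive Φ Cp)
    (h0 : (0 : Euc n) ∉ interior Cp) {u : Euc n} (hu : u ∈ recurrentSet Φ) (T : ℝ) :
    ¬ coneLL Cp u (Φ T u) := by
  intro hT
  obtain ⟨t, ht, hlim⟩ := exists_seq_of_mem_omegaSet hu
  have h0u : Φ 0 u = u := hΦ.2.1 u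
  obtain ⟨k, hk, hkT⟩ := ((hT.eventually hlim tendsto_const_nhds).and
    (ht.eventually_gt_atTop (max T 0))).exists
  obtain ⟨hkT, hk0⟩ := max_lt_iff.1 hkT
  obtain ⟨m, hm0, hm⟩ : ∃ m : ℝ, 0 < m ∧ coneLL Cp u (Φ (-m) u) := by
    refine ⟨t k - T, sub_pos.2 hkT, ?_⟩
    have := hΦ.coneLL_shift hcomp h0 hk hk0.le
    rwa [sub_self, h0u, ← neg_sub] at this
  have hopen : IsOpen {s : ℝ | coneLL Cp u (Φ s u)} :=
    (isOpen_coneLL Cp).preimage (continuous_const.prodMk (hΦ.continuous_time u))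
  obtain ⟨ε, hε, hball⟩ := Metric.isOpen_iff.1 hopen (-m) hm
  obtain ⟨s, hs, hsbig⟩ : ∃ s : ℝ, coneLL Cp u (Φ s u) ∧ m * (m / ε + 2) ≤ s := by
    have hlim' : Tendsto (fun k => Φ (T + t k) u) atTop (𝓝 (Φ T u)) := by
      simpa only [hΦ.2.2] using hΦ.tendsto_const T hlim
    obtain ⟨j, hj, hjs⟩ := ((hT.eventually tendsto_const_nhds hlim').and
      ((tendsto_atTop_add_const_left atTop T ht).eventually_ge_atTop (m * (m / ε + 2)))).exists
    exact ⟨T + t j, hj, hjs⟩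
  have hmε : 0 < m / ε := div_pos hm0 hε
  have hs0 : 0 < s := lt_of_lt_of_le (by positivity) hsbig
  have hsm : m / ε + 2 ≤ s / m := by rwa [le_div_iff₀ hm0, mul_comm]
  set N := ⌊s / m⌋₊
  have hNle : (N : ℝ) ≤ s / m := Nat.floor_le (div_pos hs0 hm0).le
  have hNlt : s / m < N + 1 := Nat.lt_floor_add_one _
  have hN1 : m / ε < N := by linarith
  have hN0 : (0 : ℝ) < N := hmε.trans hN1
  have hx : coneLL Cp u (Φ (-(s / N)) u) := by
    apply hball
    have h1 : (N : ℝ) * m ≤ s := (le_div_iff₀ hm0).1 hNle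
    have h2 : s < (N + 1) * m := (div_lt_iff₀ hm0).1 hNlt
    have h3 : m < N * ε := (div_lt_iff₀ hε).1 hN1
    have h4 : m ≤ s / N := by rw [le_div_iff₀ hN0]; linarith
    have h5 : s / N < m + ε := by rw [div_lt_iff₀ hN0]; linarith
    rw [Metric.mem_ball, Real.dist_eq, abs_lt]
    constructor <;> linarith
  have hmul : ∀ j : ℕ, coneLL Cp u (Φ (-((j + 1 : ℕ) * (s / N))) u) := by
    intro j
    induction j with
    | zero => simpa using hx
    | succ j ih =>
      refine hC.coneLL_trans hx ?_
      rw [← h0u] at ih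
      have := hΦ.coneLL_shift hcomp h0 ih (r := s / N) (by positivity)
      rw [h0u, zero_sub] at this
      convert this using 2
      push_cast
      ring
  have hneg : coneLL Cp u (Φ (-s) u) := by
    have := hmul (N - 1)
    rwa [Nat.sub_add_cancel (Nat.cast_pos.1 hN0), mul_div_cancel₀ _ hN0.ne'] at this
  rw [← h0u] at hs
  have hs' := hΦ.coneLL_shift hcomp h0 hs hs0.le
  rw [h0u, zero_sub, sub_self, h0u] at hs'
  exact (hC.coneLL_trans hneg hs').ne h0 rfl

/-- If `u` is recurrent and strongly below the recurrent point `v`, then the orbit closure of `v`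
contains a point whose orbit dominates that of `u` synchronously at all times. -/
theorem exists_mem_closure_orbit_forall_coneLe (hΦ : IsFlow Φ) (hC : IsConeOrder Cp)
    (hcomp : StronglyCompetitive Φ Cp) (hΓ : Dissipative Φ Γ) {u v : Euc n}
    (hu : u ∈ recurrentSet Φ) (hv : v ∈ recurrentSet Φ) (huv : coneLL Cp u v) :
    ∃ w ∈ closure (range fun t => Φ t v), ∀ τ, coneLe Cp (Φ τ u) (Φ τ w) := by
  obtain ⟨t, ht, hlim⟩ := exists_seq_of_mem_omegaSet hu
  have hvΓ : v ∈ Γ := hΓ.omegaSet_subset v hv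
  obtain ⟨w, -, φ, hφ, hw⟩ := hΓ.2.1.tendsto_subseq (fun k => hΓ.apply_mem hvΓ (-(t k)))
  refine ⟨w, mem_closure_of_tendsto hw (Eventually.of_forall fun k => ⟨_, rfl⟩), fun τ => ?_⟩
  refine hC.coneLe_of_tendsto tendsto_const_nhds (hΦ.tendsto_const τ hw) ?_
  have hφt : Tendsto (t ∘ φ) atTop atTop := ht.comp hφ.tendsto_atTop
  filter_upwards [huv.eventually (hlim.comp hφ.tendsto_atTop) tendsto_const_nhds,
    hφt.eventually_ge_atTop τ] with k hk hkτ
  simp only [Function.comp_apply] at hk hkτ ⊢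
  rw [← hΦ.2.1 v] at hk
  have := hΦ.coneLe_shift hcomp hk.le (sub_nonneg.2 hkτ)
  rw [hΦ.2.2]
  convert this using 2 <;> ring

/-- If every point of the orbit of `u` is synchronously dominated by the orbit of `w`, and `u` is
recurrent and outside the orbit closure of `w`, then the domination is independent of time. -/
theorem forall_coneLe_orbit (hΦ : IsFlow Φ) (hC : IsConeOrder Cp)
    (hcomp : StronglyCompetitive Φ Cp) (hΓ : Dissipative Φ Γ) {u w : Euc n}
    (hu : u ∈ recurrentSet Φ) (hw : w ∈ Γ) (huw : u ∉ closure (range fun t => Φ t w))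
    (h : ∀ τ, coneLe Cp (Φ τ u) (Φ τ w)) (s τ : ℝ) :
    coneLe Cp (Φ τ u) (Φ s w) := by
  obtain ⟨t, ht, hlim⟩ := exists_seq_of_mem_omegaSet hu
  set I : Set ℝ := {s | ∀ τ, coneLe Cp (Φ τ u) (Φ (τ + s) w)} with hI
  have hclosed : IsClosed I := by
    simp only [hI, ofPred_forall]
    refine isClosed_iInter fun τ => hC.1.preimage ?_
    exact ((hΦ.continuous_time w).comp (continuous_const.add continuous_id)).sub continuous_const
  have hopen : IsOpen I := by
    rw [isOpen_iff_mem_nhds]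
    intro s hs
    obtain ⟨z, -, φ, hφ, hz⟩ := hΓ.2.1.tendsto_subseq (fun k => hΓ.apply_mem hw (t k + s))
    have hφt : Tendsto (t ∘ φ) atTop atTop := ht.comp hφ.tendsto_atTop
    have hlimφ := hlim.comp hφ.tendsto_atTop
    have hzw : z ∈ closure (range fun t => Φ t w) :=
      mem_closure_of_tendsto hz (Eventually.of_forall fun k => ⟨_, rfl⟩)
    have hle : coneLe Cp (Φ 1 u) (Φ 1 z) := by
      refine hC.coneLe_of_tendsto (hΦ.tendsto_const 1 hlimφ) (hΦ.tendsto_const 1 hz)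
        (Eventually.of_forall fun k => ?_)
      have := hs (1 + t (φ k))
      simpa [hΦ.2.2, add_assoc] using this
    have hLL : coneLL Cp u (Φ 0 z) := by
      have := hΦ.coneLL_shift_of_coneLe hcomp hle
        (fun e => huw (hΦ.injective_s9 1 e ▸ hzw)) one_pos
      rwa [sub_self, hΦ.2.1 u] at this
    have hnear : Tendsto (fun s' => Φ (s' - s) z) (𝓝 s) (𝓝 (Φ 0 z)) := by
      have : Continuous fun s' => Φ (s' - s) z :=
        (hΦ.continuous_time z).comp (continuous_id.sub continuous_const)
      simpa using this.tendsto s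
    filter_upwards [hLL.eventually tendsto_const_nhds hnear] with s' hs' τ
    obtain ⟨k, hk, hkτ⟩ := ((hs'.eventually hlimφ (hΦ.tendsto_const (s' - s) hz)).and
      (hφt.eventually_ge_atTop τ)).exists
    simp only [Function.comp_apply, hΦ.2.2] at hk hkτ
    have := hΦ.coneLe_shift hcomp hk.le (sub_nonneg.2 hkτ)
    convert this using 2 <;> ring
  have huniv : I = univ := IsClopen.eq_univ ⟨hclosed, hopen⟩ ⟨0, fun τ => by simpa using h τ⟩
  have hs : s - τ ∈ I := huniv ▸ mem_univ _
  simpa using hs τ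

/-- Two strongly ordered recurrent points are strongly ordered again at arbitrarily late times. -/
theorem exists_ge_coneLL (hΦ : IsFlow Φ) (hC : IsConeOrder Cp)
    (hcomp : StronglyCompetitive Φ Cp) (hΓ : Dissipative Φ Γ) (h0 : (0 : Euc n) ∉ interior Cp)
    {u v : Euc n} (hu : u ∈ recurrentSet Φ) (hv : v ∈ recurrentSet Φ) (huv : coneLL Cp u v)
    (T : ℝ) : ∃ s ≥ T, coneLL Cp (Φ s u) (Φ s v) := by
  have hvΓ : v ∈ Γ := hΓ.omegaSet_subset v hv
  have huΓ : u ∈ Γ := hΓ.omegaSet_subset u hu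
  have huB : u ∉ closure (range fun t => Φ t v) := by
    intro hmem
    obtain ⟨_, hr, r, rfl⟩ := mem_closure_iff_nhds.1 hmem _
      (huv.eventually tendsto_id tendsto_const_nhds)
    have hr : coneLL Cp (Φ r v) v := hr
    refine not_coneLL_orbit hΦ hC hcomp h0 (hΦ.mem_recurrentSet hv r) (-r) ?_
    simpa [hΦ.2.2, hΦ.2.1] using hr
  obtain ⟨w, hwB, hw⟩ := exists_mem_closure_orbit_forall_coneLe hΦ hC hcomp hΓ hu hv huv
  have hwΓ : w ∈ Γ := hΓ.omegaSet_subset v (hΦ.closure_orbit_subset_omegaSet hv hwB)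
  have hsub : closure (range fun t => Φ t w) ⊆ closure (range fun t => Φ t v) := by
    refine closure_minimal ?_ isClosed_closure
    rintro _ ⟨r, rfl⟩
    exact hΦ.mem_closure_orbit hwB r
  have hall := forall_coneLe_orbit hΦ hC hcomp hΓ hu hwΓ (fun h => huB (hsub h)) hw
  obtain ⟨σ, hσ, hσw⟩ := exists_seq_of_mem_omegaSet (hΦ.closure_orbit_subset_omegaSet hv hwB)
  obtain ⟨a, -, φ, hφ, ha⟩ := hΓ.2.1.tendsto_subseq (fun k => hΓ.apply_mem huΓ (σ k))
  have hσφ : Tendsto (σ ∘ φ) atTop atTop := hσ.comp hφ.tendsto_atTop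
  have haw : coneLe Cp a (Φ 0 w) :=
    hC.coneLe_of_tendsto ha tendsto_const_nhds (Eventually.of_forall fun k => hall 0 (σ (φ k)))
  by_cases hne : a = w
  · exfalso
    subst hne
    have hlt : coneLL Cp (Φ (0 - 1) u) (Φ (0 - 1) a) :=
      hΦ.coneLL_shift_of_coneLe hcomp (hall 0 0)
        (fun e => huB (hΦ.injective_s9 0 e ▸ hwB)) one_pos
    obtain ⟨k, hk⟩ := (hlt.eventually tendsto_const_nhds (hΦ.tendsto_const (0 - 1) ha)).exists
    refine not_coneLL_orbit hΦ hC hcomp h0 (hΦ.mem_recurrentSet hu (0 - 1)) (σ (φ k)) ?_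
    simpa [hΦ.2.2, add_comm] using hk
  · have hlt : coneLL Cp (Φ (0 - 1) a) (Φ (0 - 1) w) := by
      rw [← hΦ.2.1 a] at haw
      exact hΦ.coneLL_shift_of_coneLe hcomp haw (fun e => hne (hΦ.injective_s9 0 e)) one_pos
    obtain ⟨k, hk, hkT⟩ := ((hlt.eventually (hΦ.tendsto_const (0 - 1) ha)
      (hΦ.tendsto_const (0 - 1) (hσw.comp hφ.tendsto_atTop))).and
      (hσφ.eventually_ge_atTop (T + 1))).exists
    simp only [Function.comp_apply, hΦ.2.2] at hk hkT
    exact ⟨0 - 1 + σ (φ k), by linarith, hk⟩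

/-- Recurrent points strongly ordered in backward time are ordered. -/
theorem coneLe_of_coneLL_backward (hΦ : IsFlow Φ) (hC : IsConeOrder Cp)
    (hcomp : StronglyCompetitive Φ Cp) (hΓ : Dissipative Φ Γ) (h0 : (0 : Euc n) ∉ interior Cp)
    {u v : Euc n} (hu : u ∈ recurrentSet Φ) (hv : v ∈ recurrentSet Φ)
    (huv : coneLL Cp (Φ (-1) u) (Φ (-1) v)) : coneLe Cp u v := by
  obtain ⟨s, hs, h⟩ := exists_ge_coneLL hΦ hC hcomp hΓ h0 (hΦ.mem_recurrentSet hu (-1))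
    (hΦ.mem_recurrentSet hv (-1)) huv 1
  have := hΦ.coneLe_shift hcomp h.le (r := s - 1) (by linarith)
  simpa [hΦ.2.2, hΦ.2.1] using this

end Flow

theorem stmt9 {n : ℕ} (Φ : ℝ → Euc n → Euc n) (Cp Γ : Set (Euc n))
    (hΦ : IsFlow Φ) (hC : IsConeOrder Cp) (hcomp : StronglyCompetitive Φ Cp)
    (hΓ : Dissipative Φ Γ)
    (S : Set (Euc n)) (hS : S ⊆ birkhoffCenter Φ) (hconn : IsPreconnected S)
    (x : Euc n) (hx : x ∈ recurrentSet Φ)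
    (b c : Euc n) (hb : b ∈ S) (hc : c ∈ S)
    (hbC : b ∈ interior (coneCAt Cp x)) (hcK : c ∈ interior (coneKAt Cp x)) :
    x ∈ S := by
  by_contra hxS
  have hcC : c ∉ coneCAt Cp x := hC.notMem_coneCAt hcK
  have h0 : (0 : Euc n) ∉ interior Cp := hC.zero_notMem_interior fun h => hcC (Or.inl h)
  have hclosed := hC.isClosed_coneCAt x
  obtain ⟨y, hyS, hyC, hycl⟩ : (S ∩ (coneCAt Cp x ∩ closure (S \ coneCAt Cp x))).Nonempty := by
    refine isPreconnected_closed_iff.1 hconn _ _ hclosed isClosed_closure ?_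
      ⟨b, hb, interior_subset hbC⟩ ⟨c, hc, subset_closure ⟨hc, hcC⟩⟩
    intro z hz
    by_cases hzC : z ∈ coneCAt Cp x
    · exact Or.inl hzC
    · exact Or.inr (subset_closure ⟨hz, hzC⟩)
  have hyx : y ≠ x := fun e => hxS (e ▸ hyS)
  have hyR : y ∈ closure (recurrentSet Φ \ coneCAt Cp x) := by
    refine closure_minimal ?_ isClosed_closure hycl
    rintro z ⟨hzS, hzC⟩
    have := hclosed.isOpen_compl.inter_closure ⟨hzC, hS hzS⟩
    rwa [inter_comm] at this
  have hcont : Tendsto (Φ (-1)) (𝓝 y) (𝓝 (Φ (-1) y)) := hΦ.tendsto_const (-1) tendsto_id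
  have hback : ∀ {p q : Euc n}, p ≠ q → coneLe Cp p q → coneLL Cp (Φ (-1) p) (Φ (-1) q) := by
    intro p q hne h
    rw [← hΦ.2.1 p, ← hΦ.2.1 q] at h
    simpa using hΦ.coneLL_shift_of_coneLe hcomp h (fun e => hne (hΦ.injective_s9 0 e)) one_pos
  rcases hyC with hle | hle
  · obtain ⟨z, hz, hzR, hzC⟩ := mem_closure_iff_nhds.1 hyR _
      ((hback hyx.symm hle).eventually tendsto_const_nhds hcont)
    exact hzC (Or.inl (coneLe_of_coneLL_backward hΦ hC hcomp hΓ h0 hx hzR hz))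
  · have hle : coneLe Cp y x := by simpa [coneLe] using hle
    obtain ⟨z, hz, hzR, hzC⟩ := mem_closure_iff_nhds.1 hyR _
      ((hback hyx hle).eventually hcont tendsto_const_nhds)
    have := coneLe_of_coneLL_backward hΦ hC hcomp hΓ h0 hzR hx hz
    exact hzC (Or.inr (by simpa [coneLe] using this))
end
end

section
/- Assume (H1)-(H2). Let B be a connected component of the Birkhoff center 𝓑(Φ). Then either B is unordered, or B consists of equilibria and any two distinct points of B are related by ≪. -/
open Set Metric Filter Topology Pointwise

noncomputable section

/-- A continuous flow whose time reversal is strongly monotone for a closed partial order `le`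
with an open strict part `ll`. -/
structure IsCompetitiveFlow {E : Type*} [TopologicalSpace E] (Φ : ℝ → E → E)
    (le ll : E → E → Prop) : Prop where
  cont : Continuous fun p : ℝ × E => Φ p.1 p.2
  zero : ∀ x, Φ 0 x = x
  add : ∀ t s x, Φ t (Φ s x) = Φ (t + s) x
  refl : ∀ x, le x x
  trans : ∀ x y z, le x y → le y z → le x z
  antisymm : ∀ x y, le x y → le y x → x = y
  le_of_ll : ∀ x y, ll x y → le x y
  irrefl : ∀ x, ¬ ll x x
  isClosed_le : IsClosed {p : E × E | le p.1 p.2}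
  isOpen_ll : IsOpen {p : E × E | ll p.1 p.2}
  strong : ∀ t < 0, ∀ x y, le x y → x ≠ y → ll (Φ t x) (Φ t y)

/-- The points that are cluster points of their own forward orbit. -/
def recurrentPoints {E : Type*} [TopologicalSpace E] (Φ : ℝ → E → E) : Set E :=
  {x | MapClusterPt x atTop fun t => Φ t x}

/-- The closure of the full orbit of a point. -/
def orbitClosure {E : Type*} [TopologicalSpace E] (Φ : ℝ → E → E) (x : E) : Set E :=
  closure (range fun t => Φ t x)

/-- An additively closed set of reals containing a neighbourhood of some positive number contains
all large numbers. -/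
lemma exists_forall_ge_mem_of_add_mem {S : Set ℝ} (hS : ∀ s ∈ S, ∀ t ∈ S, s + t ∈ S) {T : ℝ}
    (hT : 0 < T) (hnear : S ∈ 𝓝 T) : ∃ M, ∀ t ≥ M, t ∈ S := by
  obtain ⟨δ, hδ, hball⟩ := Metric.mem_nhds_iff.1 hnear
  have hmul : ∀ k : ℕ, ∀ s ∈ S, ((k + 1 : ℕ) : ℝ) * s ∈ S := by
    intro k s hs
    induction k with
    | zero => simpa using hs
    | succ k ih =>
      have := hS _ ih _ hs
      convert this using 1
      push_cast
      ring
  refine ⟨T ^ 2 / δ + 1, fun t ht => ?_⟩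
  have ht0 : 0 < t := lt_of_lt_of_le (by positivity) ht
  have ht1 : T ^ 2 < t * δ := by
    rw [← div_lt_iff₀ hδ]
    linarith
  set k := ⌊t / T⌋₊ with hk
  have hk1 : (k : ℝ) * T ≤ t := by
    rw [← le_div_iff₀ hT]
    exact Nat.floor_le (by positivity)
  have hk2 : t < ((k : ℝ) + 1) * T := by
    rw [← div_lt_iff₀ hT]
    exact Nat.lt_floor_add_one _
  have hkpos : (0 : ℝ) < (k : ℝ) + 1 := by positivity
  have hmem : t / ((k : ℝ) + 1) ∈ S := by
    apply hball
    rw [Metric.mem_ball, Real.dist_eq, abs_lt]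
    constructor
    · rw [lt_sub_iff_add_lt, lt_div_iff₀ hkpos]
      by_contra! h
      nlinarith
    · have : t / ((k : ℝ) + 1) < T := by
        rw [div_lt_iff₀ hkpos]
        linarith
      linarith
  have := hmul k _ hmem
  convert this using 1
  push_cast
  field_simp

namespace IsCompetitiveFlow

variable {E : Type*} [TopologicalSpace E] {Φ : ℝ → E → E} {le ll : E → E → Prop}

lemma dual (M : IsCompetitiveFlow Φ le ll) :
    IsCompetitiveFlow Φ (fun x y => le y x) (fun x y => ll y x) where
  cont := M.cont
  zero := M.zero
  add := M.add
  refl := M.refl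
  trans _ _ _ h h' := M.trans _ _ _ h' h
  antisymm _ _ h h' := M.antisymm _ _ h' h
  le_of_ll _ _ h := M.le_of_ll _ _ h
  irrefl := M.irrefl
  isClosed_le := M.isClosed_le.preimage continuous_swap
  isOpen_ll := M.isOpen_ll.preimage continuous_swap
  strong t ht _ _ h hne := M.strong t ht _ _ h hne.symm

lemma continuous_apply (M : IsCompetitiveFlow Φ le ll) (t : ℝ) : Continuous (Φ t) :=
  M.cont.comp (by fun_prop : Continuous fun x : E => (t, x))

lemma continuous_orbit (M : IsCompetitiveFlow Φ le ll) (x : E) : Continuous fun t => Φ t x :=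
  M.cont.comp (by fun_prop : Continuous fun t : ℝ => (t, x))

lemma neg_apply (M : IsCompetitiveFlow Φ le ll) (t : ℝ) (x : E) : Φ (-t) (Φ t x) = x := by
  rw [M.add, neg_add_cancel, M.zero]

lemma apply_neg (M : IsCompetitiveFlow Φ le ll) (t : ℝ) (x : E) : Φ t (Φ (-t) x) = x := by
  rw [M.add, add_neg_cancel, M.zero]

lemma injective (M : IsCompetitiveFlow Φ le ll) (t : ℝ) : Function.Injective (Φ t) :=
  Function.LeftInverse.injective (M.neg_apply t)

lemma mono (M : IsCompetitiveFlow Φ le ll) {t : ℝ} (ht : t ≤ 0) {x y : E} (h : le x y) :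
    le (Φ t x) (Φ t y) := by
  rcases ht.lt_or_eq with ht | rfl
  · by_cases hne : x = y
    · subst hne
      exact M.refl _
    · exact M.le_of_ll _ _ (M.strong t ht _ _ h hne)
  · simpa only [M.zero] using h

lemma isOpen_ll_comp (M : IsCompetitiveFlow Φ le ll) {Z : Type*} [TopologicalSpace Z] {f g : Z → E}
    (hf : Continuous f) (hg : Continuous g) : IsOpen {z | ll (f z) (g z)} :=
  M.isOpen_ll.preimage (hf.prodMk hg)

lemma isClosed_le_comp (M : IsCompetitiveFlow Φ le ll) {Z : Type*} [TopologicalSpace Z]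
    {f g : Z → E} (hf : Continuous f) (hg : Continuous g) : IsClosed {z | le (f z) (g z)} :=
  M.isClosed_le.preimage (hf.prodMk hg)

lemma exists_return {r : E} (hr : r ∈ recurrentPoints Φ) {U : Set E} (hU : U ∈ 𝓝 r) (T : ℝ) :
    ∃ t ≥ T, Φ t r ∈ U :=
  (frequently_atTop.1 (mapClusterPt_iff_frequently.1 hr U hU)) T

lemma apply_mem_recurrentPoints (M : IsCompetitiveFlow Φ le ll) {r : E}
    (hr : r ∈ recurrentPoints Φ) (t : ℝ) : Φ t r ∈ recurrentPoints Φ := by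
  have h := MapClusterPt.continuousAt_comp (M.continuous_apply t).continuousAt hr
  refine (congrArg (MapClusterPt _ atTop) ?_).mp h
  funext s
  simp only [Function.comp, M.add, add_comm]

lemma apply_mem_center (M : IsCompetitiveFlow Φ le ll) {x : E}
    (hx : x ∈ closure (recurrentPoints Φ)) (t : ℝ) : Φ t x ∈ closure (recurrentPoints Φ) :=
  map_mem_closure (M.continuous_apply t) hx fun _ hr => M.apply_mem_recurrentPoints hr t

lemma self_mem_orbitClosure (M : IsCompetitiveFlow Φ le ll) (x : E) : x ∈ orbitClosure Φ x :=
  subset_closure ⟨0, M.zero x⟩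

lemma apply_mem_orbitClosure (M : IsCompetitiveFlow Φ le ll) {x y : E}
    (hy : y ∈ orbitClosure Φ x) (t : ℝ) : Φ t y ∈ orbitClosure Φ x := by
  refine map_mem_closure (M.continuous_apply t) hy ?_
  rintro _ ⟨s, rfl⟩
  exact ⟨t + s, (M.add _ _ _).symm⟩

lemma orbitClosure_subset (M : IsCompetitiveFlow Φ le ll) {x y : E}
    (hy : y ∈ orbitClosure Φ x) : orbitClosure Φ y ⊆ orbitClosure Φ x := by
  refine closure_minimal ?_ isClosed_closure
  rintro _ ⟨t, rfl⟩
  exact M.apply_mem_orbitClosure hy t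

lemma orbitClosure_subset_center (M : IsCompetitiveFlow Φ le ll) {x : E}
    (hx : x ∈ closure (recurrentPoints Φ)) :
    orbitClosure Φ x ⊆ closure (recurrentPoints Φ) := by
  refine closure_minimal ?_ isClosed_closure
  rintro _ ⟨t, rfl⟩
  exact M.apply_mem_center hx t

lemma isPreconnected_orbitClosure (M : IsCompetitiveFlow Φ le ll) (x : E) :
    IsPreconnected (orbitClosure Φ x) :=
  (isPreconnected_range (M.continuous_orbit x)).closure

/-- No point of the orbit of a recurrent point at a positive time lies above that point. -/
lemma eq_of_le_apply_of_pos (M : IsCompetitiveFlow Φ le ll) {r : E} (hr : r ∈ recurrentPoints Φ)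
    {T : ℝ} (hT : 0 < T) (h : le r (Φ T r)) : r = Φ T r := by
  by_contra hne
  have hstep : ∀ᶠ t in 𝓝 T, ∀ s, le (Φ s r) (Φ (s + t) r) := by
    have h1 : ll (Φ (-1) r) (Φ (-1 + T) r) := by
      simpa only [M.add] using M.strong (-1) (by norm_num) _ _ h hne
    have hopen : IsOpen {t : ℝ | ll (Φ (-1) r) (Φ (-1 + t) r)} :=
      M.isOpen_ll_comp continuous_const ((M.continuous_orbit r).comp (continuous_const_add (-1)))
    filter_upwards [hopen.mem_nhds h1] with t ht s
    have hopen' : IsOpen {x | ll (Φ (-1) x) (Φ (-1 + t) x)} :=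
      M.isOpen_ll_comp (M.continuous_apply _) (M.continuous_apply _)
    obtain ⟨τ, hτ, hll⟩ := exists_return hr (hopen'.mem_nhds ht) (s + 1)
    have := M.mono (t := s + 1 - τ) (by linarith) (M.le_of_ll _ _ hll)
    simp only [M.add] at this
    convert this using 2 <;> ring
  obtain ⟨N, hN⟩ := exists_forall_ge_mem_of_add_mem
    (S := {t | ∀ s, le (Φ s r) (Φ (s + t) r)}) (fun a ha b hb s => by
      have := M.trans _ _ _ (ha s) (hb (s + a))
      rwa [add_assoc] at this) hT hstep
  have hle : le (Φ T r) r := by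
    by_contra hcon
    have hopen : IsOpen {x | ¬ le (Φ T r) x} :=
      (M.isClosed_le_comp continuous_const continuous_id).isOpen_compl
    obtain ⟨τ, hτ, hnot⟩ := exists_return hr (hopen.mem_nhds hcon) (T + N)
    refine hnot ?_
    have := hN (τ - T) (by linarith) T
    rwa [add_sub_cancel] at this
  exact hne (M.antisymm _ _ h hle)

lemma eq_of_le_apply (M : IsCompetitiveFlow Φ le ll) {r : E} (hr : r ∈ recurrentPoints Φ)
    {T : ℝ} (h : le r (Φ T r)) : r = Φ T r := by
  rcases lt_trichotomy T 0 with hT | rfl | hT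
  · have h' : le (Φ (-T) (Φ T r)) (Φ T r) := by rwa [M.neg_apply]
    have := M.dual.eq_of_le_apply_of_pos (M.apply_mem_recurrentPoints hr T) (neg_pos.2 hT) h'
    rw [M.neg_apply] at this
    exact this.symm
  · exact (M.zero r).symm
  · exact M.eq_of_le_apply_of_pos hr hT h

/-- Orbit closures of points of the Birkhoff center are unordered. -/
lemma orbitClosure_unordered (M : IsCompetitiveFlow Φ le ll) {a : E}
    (ha : a ∈ closure (recurrentPoints Φ)) {p q : E} (hp : p ∈ orbitClosure Φ a)
    (hq : q ∈ orbitClosure Φ a) (h : le p q) : p = q := by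
  by_contra hne
  have hll := M.strong (-1) (by norm_num) _ _ h hne
  have hmem : (Φ (-1) p, Φ (-1) q) ∈
      closure ((range fun t => Φ t a) ×ˢ (range fun t => Φ t a)) := by
    rw [closure_prod_eq]
    exact ⟨M.apply_mem_orbitClosure hp _, M.apply_mem_orbitClosure hq _⟩
  obtain ⟨⟨_, _⟩, hx, ⟨s, rfl⟩, ⟨t, rfl⟩⟩ := mem_closure_iff.1 hmem _ M.isOpen_ll hll
  have hopen : IsOpen {x | ll (Φ s x) (Φ t x)} :=
    M.isOpen_ll_comp (M.continuous_apply _) (M.continuous_apply _)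
  obtain ⟨r, hr, hrec⟩ := mem_closure_iff.1 ha _ hopen hx
  have heq : Φ (t - s) (Φ s r) = Φ t r := by rw [M.add, sub_add_cancel]
  have := M.eq_of_le_apply (M.apply_mem_recurrentPoints hrec s) (T := t - s)
    (by rw [heq]; exact M.le_of_ll _ _ hr)
  rw [heq] at this
  have hr' : ll (Φ s r) (Φ t r) := hr
  rw [← this] at hr'
  exact M.irrefl _ hr'

lemma isOpen_forall_ll (M : IsCompetitiveFlow Φ le ll) {P : Set E} (hP : IsCompact P) :
    IsOpen {y | ∀ p ∈ P, ll p y} := by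
  rw [isOpen_iff_mem_nhds]
  intro y hy
  refine hP.eventually_forall_of_forall_eventually fun p hp => ?_
  exact (M.isOpen_ll_comp continuous_snd continuous_fst).mem_nhds (hy p hp)

/-- A point of the Birkhoff center that lies above a compact invariant set lies strongly above
it. -/
lemma forall_ll_of_forall_le (M : IsCompetitiveFlow Φ le ll) {P : Set E} (hP : IsCompact P)
    (hinv : ∀ t, ∀ p ∈ P, Φ t p ∈ P) {y : E} (hy : y ∈ closure (recurrentPoints Φ))
    (hle : ∀ p ∈ P, le p y) (hyP : y ∉ P) : ∀ p ∈ P, ll p y := by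
  have hback : ∀ t < 0, ∀ z, (∀ p ∈ P, le p z) → z ∉ P → ∀ p ∈ P, ll p (Φ t z) := by
    intro t ht z hz hzP p hp
    have hp' := hinv (-t) p hp
    have := M.strong t ht _ _ (hz _ hp') fun h => hzP (h ▸ hp')
    rwa [M.apply_neg] at this
  have hforward : ∀ p ∈ P, le p (Φ 1 y) := by
    intro p hp
    by_contra hcon
    have hopen : IsOpen ({x | ¬ le p x} ∩ Φ (-2) ⁻¹' {z | ∀ p ∈ P, ll p z}) :=
      (M.isClosed_le_comp continuous_const continuous_id).isOpen_compl.inter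
        ((M.isOpen_forall_ll hP).preimage (M.continuous_apply _))
    have hmem : Φ 1 y ∈ {x | ¬ le p x} ∩ Φ (-2) ⁻¹' {z | ∀ p ∈ P, ll p z} := by
      refine ⟨hcon, ?_⟩
      have := hback (-1) (by norm_num) y hle hyP
      rw [mem_preimage, M.add, show (-2 + 1 : ℝ) = -1 by norm_num]
      exact this
    obtain ⟨r, hrU, hr⟩ := mem_closure_iff.1 (M.apply_mem_center hy 1) _ hopen hmem
    obtain ⟨t, ht, htU⟩ := exists_return hr (hopen.mem_nhds hrU) 2
    refine hrU.1 ?_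
    have := M.mono (t := 2 - t) (by linarith) (M.le_of_ll _ _ (htU.2 _ (hinv (t - 2) p hp)))
    simp only [M.add] at this
    convert this using 1
    · rw [show 2 - t + (t - 2) = 0 by ring, M.zero]
    · rw [show 2 - t + (-2 + t) = 0 by ring, M.zero]
  have hnot : Φ 1 y ∉ P := fun h => hyP (by simpa only [M.neg_apply] using hinv (-1) _ h)
  have := hback (-1) (by norm_num) _ hforward hnot
  simpa only [M.neg_apply] using this

/-- A connected part of the Birkhoff center with a point above a compact invariant unordered set
with at least two points lies strongly above that set. -/
lemma forall_ll_or_subsingleton (M : IsCompetitiveFlow Φ le ll) {P : Set E} (hP : IsCompact P)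
    (hinv : ∀ t, ∀ p ∈ P, Φ t p ∈ P) (hun : ∀ p ∈ P, ∀ q ∈ P, le p q → p = q) {B : Set E}
    (hB : IsPreconnected B) (hBX : B ⊆ closure (recurrentPoints Φ)) {q : E} (hq : q ∈ B)
    (hle : ∀ p ∈ P, le p q) : (∀ y ∈ B, ∀ p ∈ P, ll p y) ∨ P.Subsingleton := by
  by_cases hsub : P.Subsingleton
  · exact Or.inr hsub
  have key : ∀ y ∈ B, (∀ p ∈ P, le p y) → ∀ p ∈ P, ll p y := fun y hy h =>
    M.forall_ll_of_forall_le hP hinv (hBX hy) h fun hyP =>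
      hsub fun p hp p' hp' => (hun p hp y hyP (h p hp)).trans (hun p' hp' y hyP (h p' hp')).symm
  have hcl : IsClosed {y | ∀ p ∈ P, le p y} := by
    simp only [ofPred_forall]
    exact isClosed_biInter fun p _ => M.isClosed_le_comp continuous_const continuous_id
  have hsubset := hB.subset_left_of_subset_union (M.isOpen_forall_ll hP) hcl.isOpen_compl
    (disjoint_compl_right_iff_subset.2 fun y hy p hp => M.le_of_ll _ _ (hy p hp))
    (fun y hy => (em (∀ p ∈ P, le p y)).imp (key y hy) id) ⟨q, hq, key q hq hle⟩
  exact Or.inl hsubset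

/-- A recurrent point below a point of the Birkhoff center lies below a whole orbit in the orbit
closure of that point. -/
lemma exists_forall_le_orbit (M : IsCompetitiveFlow Φ le ll)
    {r b : E} (hr : r ∈ recurrentPoints Φ) (hL : IsCompact (orbitClosure Φ b)) (h : le r b)
    (hrL : r ∉ orbitClosure Φ b) : ∃ q ∈ orbitClosure Φ b, ∀ t, le r (Φ t q) := by
  let H : Set E := orbitClosure Φ b ∩ {q | le r q}
  have hHc : IsCompact H :=
    hL.inter_right (M.isClosed_le_comp continuous_const continuous_id)
  have hnear : ∀ᶠ z : E × ℝ in 𝓝 (r, 0), ∀ q ∈ H, ll (Φ (-1) z.1) (Φ (-1 + z.2) q) := by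
    refine hHc.eventually_forall_of_forall_eventually fun q hq => ?_
    have hopen : IsOpen {w : (E × ℝ) × E | ll (Φ (-1) w.1.1) (Φ (-1 + w.1.2) w.2)} :=
      M.isOpen_ll_comp ((M.continuous_apply _).comp (by fun_prop))
        (M.cont.comp (by fun_prop : Continuous fun w : (E × ℝ) × E => (-1 + w.1.2, w.2)))
    refine hopen.mem_nhds ?_
    simp only [mem_ofPred_eq, add_zero]
    exact M.strong (-1) (by norm_num) _ _ hq.2 fun h => hrL (h ▸ hq.1)
  rw [nhds_prod_eq] at hnear
  obtain ⟨pa, hpa, pb, hpb, hab⟩ := eventually_prod_iff.1 hnear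
  obtain ⟨τ, hτ, hτpa⟩ := exists_return hr hpa 1
  obtain ⟨N, hN⟩ := exists_forall_ge_mem_of_add_mem (S := {t | ∀ q ∈ H, Φ (-t) q ∈ H})
    (T := τ) (fun s hs t ht q hq => by
      have := hs _ (ht q hq)
      rwa [M.add, ← neg_add] at this) (by linarith) (by
      have htend : Tendsto (fun t => τ - t) (𝓝 τ) (𝓝 0) := by
        have : Continuous fun t => τ - t := by fun_prop
        simpa using this.tendsto τ
      filter_upwards [htend.eventually hpb] with t ht q hq
      refine ⟨M.apply_mem_orbitClosure hq.1 _, ?_⟩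
      change le r (Φ (-t) q)
      have := M.mono (t := 1 - τ) (by linarith) (M.le_of_ll _ _ (hab hτpa ht q hq))
      simp only [M.add] at this
      convert this using 1
      · rw [show 1 - τ + (-1 + τ) = 0 by ring, M.zero]
      · congr 1
        ring)
  have hbH : b ∈ H := ⟨M.self_mem_orbitClosure b, h⟩
  let D : ℕ → Set E := fun k => orbitClosure Φ b ∩ {q | ∀ t ∈ Icc (-k : ℝ) k, le r (Φ t q)}
  have hDcl : ∀ k : ℕ, IsClosed {q | ∀ t ∈ Icc (-k : ℝ) k, le r (Φ t q)} := by
    intro k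
    simp only [ofPred_forall]
    exact isClosed_biInter fun t _ => M.isClosed_le_comp continuous_const (M.continuous_apply t)
  obtain ⟨q, hq⟩ := IsCompact.nonempty_iInter_of_sequence_nonempty_isCompact_isClosed D
    (fun k q hq => ⟨hq.1, fun t ht => hq.2 t (by
      simp only [mem_Icc, Nat.cast_add, Nat.cast_one] at ht ⊢
      constructor <;> linarith [ht.1, ht.2])⟩)
    (fun k => ⟨Φ (-(N + k)) b, M.apply_mem_orbitClosure (M.self_mem_orbitClosure b) _,
      fun t ht => by
        have : le r (Φ (-(N + k - t)) b) := (hN (N + k - t) (by linarith [ht.2]) b hbH).2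
        rw [M.add]
        convert this using 2
        ring⟩)
    (hL.inter_right (hDcl 0)) (fun k => isClosed_closure.inter (hDcl k))
  rw [mem_iInter] at hq
  refine ⟨q, (hq 0).1, fun t => ?_⟩
  obtain ⟨k, hk⟩ := exists_nat_ge |t|
  exact (hq k).2 t (abs_le.1 hk)

/-- A recurrent point strongly below a point of a connected part `B` of the Birkhoff center is an
equilibrium or lies below `B`. -/
lemma recurrent_fixed_or_forall_le (M : IsCompetitiveFlow Φ le ll) [T2Space E]
    (hX : IsCompact (closure (recurrentPoints Φ))) {B : Set E} (hB : IsPreconnected B)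
    (hBX : B ⊆ closure (recurrentPoints Φ)) {r b : E} (hr : r ∈ recurrentPoints Φ)
    (hb : orbitClosure Φ b ⊆ B) (h : ll r b) : (∀ t, Φ t r = r) ∨ ∀ y ∈ B, le r y := by
  have hbX := hBX (hb (M.self_mem_orbitClosure b))
  have hLc : ∀ x ∈ closure (recurrentPoints Φ), IsCompact (orbitClosure Φ x) := fun x hx =>
    hX.of_isClosed_subset isClosed_closure (M.orbitClosure_subset_center hx)
  have hrL : r ∉ orbitClosure Φ b := fun hmem => by
    have := M.orbitClosure_unordered hbX hmem (M.self_mem_orbitClosure b) (M.le_of_ll _ _ h)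
    exact M.irrefl _ (this ▸ h)
  obtain ⟨q, hqL, hq⟩ := M.exists_forall_le_orbit hr (hLc b hbX) (M.le_of_ll _ _ h) hrL
  have hqc := hLc q (hBX (hb hqL))
  have hLq : ∀ z ∈ orbitClosure Φ q, le r z := closure_minimal (by
    rintro _ ⟨t, rfl⟩
    exact hq t) (M.isClosed_le_comp continuous_const continuous_id)
  have hLrq : ∀ p ∈ orbitClosure Φ r, le p q := by
    refine closure_minimal ?_ (M.isClosed_le_comp continuous_id continuous_const)
    rintro _ ⟨t, rfl⟩
    have hll : ∀ z ∈ orbitClosure Φ q, ll (Φ (-1) r) z := fun z hz => by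
      have hz' := M.apply_mem_orbitClosure hz 1
      have := M.strong (-1) (by norm_num) _ _ (hLq _ hz')
        fun heq => hrL (heq ▸ M.orbitClosure_subset hqL hz')
      rwa [M.neg_apply] at this
    have hopen : IsOpen {x | ∀ z ∈ orbitClosure Φ q, ll (Φ (-1) x) z} :=
      (M.dual.isOpen_forall_ll hqc).preimage (M.continuous_apply _)
    obtain ⟨τ, hτ, hτU⟩ := exists_return hr (hopen.mem_nhds hll) (t + 1)
    have := M.mono (t := t + 1 - τ) (by linarith) (M.le_of_ll _ _ (hτU _
      (M.apply_mem_orbitClosure (M.self_mem_orbitClosure q) (-(t + 1 - τ)))))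
    rw [M.apply_neg, M.add, M.add] at this
    change le (Φ t r) q
    convert this using 2
    ring
  have hrX : r ∈ closure (recurrentPoints Φ) := subset_closure hr
  rcases M.forall_ll_or_subsingleton (hLc r hrX) (fun t p hp => M.apply_mem_orbitClosure hp t)
    (fun p hp p' hp' => M.orbitClosure_unordered hrX hp hp') hB hBX (hb hqL) hLrq with h1 | h1
  · exact Or.inr fun y hy => M.le_of_ll _ _ (h1 y hy r (M.self_mem_orbitClosure r))
  · exact Or.inl fun t => h1 (M.apply_mem_orbitClosure (M.self_mem_orbitClosure r) t)
      (M.self_mem_orbitClosure r)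

/-- A point of an invariant connected part of the Birkhoff center with another point of it above
is an equilibrium. -/
lemma fixed_of_le (M : IsCompetitiveFlow Φ le ll) [T2Space E]
    (hX : IsCompact (closure (recurrentPoints Φ))) {B : Set E} (hB : IsPreconnected B)
    (hBX : B ⊆ closure (recurrentPoints Φ)) (hinv : ∀ a ∈ B, orbitClosure Φ a ⊆ B) {a b : E}
    (ha : a ∈ B) (hb : b ∈ B) (h : le a b) (hne : a ≠ b) (t : ℝ) : Φ t a = a := by
  set a' := Φ (-1) a
  set b' := Φ (-1) b
  have ha'B : a' ∈ B := hinv a ha (M.apply_mem_orbitClosure (M.self_mem_orbitClosure a) _)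
  have hb'B : b' ∈ B := hinv b hb (M.apply_mem_orbitClosure (M.self_mem_orbitClosure b) _)
  have hll : ll a' b' := M.strong (-1) (by norm_num) _ _ h hne
  have hopen : IsOpen {x | ll x b'} := M.isOpen_ll_comp continuous_id continuous_const
  have hcl : IsClosed ({x | ∀ t, Φ t x = x} ∪ {x | ∀ y ∈ B, le x y}) := by
    refine IsClosed.union ?_ ?_
    · simp only [ofPred_forall]
      exact isClosed_iInter fun t => isClosed_eq (M.continuous_apply t) continuous_id
    · simp only [ofPred_forall]
      exact isClosed_biInter fun y _ => M.isClosed_le_comp continuous_id continuous_const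
  have hmem : a' ∈ closure ({x | ll x b'} ∩ recurrentPoints Φ) :=
    hopen.inter_closure ⟨hll, hBX ha'B⟩
  have hfix : ∀ t, Φ t a' = a' := by
    rcases closure_minimal (fun r hr => M.recurrent_fixed_or_forall_le hX hB hBX hr.2
      (hinv b' hb'B) hr.1) hcl hmem with h1 | h1
    · exact h1
    · intro t
      have hta := M.apply_mem_orbitClosure (M.self_mem_orbitClosure a') t
      exact (M.orbitClosure_unordered (hBX ha'B) (M.self_mem_orbitClosure a') hta
        (h1 _ (hinv a' ha'B hta))).symm
  apply M.injective (-1)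
  rw [M.add, add_comm, ← M.add]
  exact hfix t

lemma ll_of_le (M : IsCompetitiveFlow Φ le ll) {e y : E} (he : ∀ t, Φ t e = e)
    (hy : y ∈ closure (recurrentPoints Φ)) (h : le e y) (hne : e ≠ y) : ll e y :=
  M.forall_ll_of_forall_le isCompact_singleton
    (fun t p hp => by rw [mem_singleton_iff] at hp ⊢; rw [hp, he]) hy
    (fun p hp => by rwa [mem_singleton_iff.1 hp]) (fun hy' => hne (mem_singleton_iff.1 hy').symm)
    e rfl

lemma comparable_of_le (M : IsCompetitiveFlow Φ le ll) [T2Space E]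
    (hX : IsCompact (closure (recurrentPoints Φ))) {B : Set E} (hB : IsPreconnected B)
    (hBX : B ⊆ closure (recurrentPoints Φ)) (hinv : ∀ a ∈ B, orbitClosure Φ a ⊆ B) {a b : E}
    (ha : a ∈ B) (hb : b ∈ B) (h : le a b) (hne : a ≠ b) {w : E} (hw : w ∈ B) :
    le a w ∨ le w a := by
  by_contra hcon
  rw [not_or] at hcon
  have hll : ∀ {x y}, x ∈ B → y ∈ B → le x y → x ≠ y → ll x y := fun hx hy hle hne =>
    M.ll_of_le (M.fixed_of_le hX hB hBX hinv hx hy hle hne) (hBX hy) hle hne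
  have hopen_not_le : ∀ c, IsOpen {y | ¬ le c y} := fun c =>
    (M.isClosed_le_comp continuous_const continuous_id).isOpen_compl
  have hopen_not_ge : ∀ c, IsOpen {y | ¬ le y c} := fun c =>
    (M.isClosed_le_comp continuous_id continuous_const).isOpen_compl
  have hopen_ll : ∀ c, IsOpen {y | ll c y} := fun c =>
    M.isOpen_ll_comp continuous_const continuous_id
  have hopen_gg : ∀ c, IsOpen {y | ll y c} := fun c =>
    M.isOpen_ll_comp continuous_id continuous_const
  obtain ⟨v, hvB, ⟨hv1, hv2⟩, hv⟩ := hB ({y | ¬ le a y} ∩ {y | ¬ le y a})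
    ({y | ll a y} ∪ {y | ll y a} ∪ {y | ll y b})
    ((hopen_not_le a).inter (hopen_not_ge a))
    (((hopen_ll a).union (hopen_gg a)).union (hopen_gg b))
    (fun y hy => by
      by_cases hya : y = a
      · subst hya
        exact Or.inr (Or.inr (hll ha hb h hne))
      by_cases h1 : le a y
      · exact Or.inr (Or.inl (Or.inl (hll ha hy h1 (Ne.symm hya))))
      by_cases h2 : le y a
      · exact Or.inr (Or.inl (Or.inr (hll hy ha h2 hya)))
      exact Or.inl ⟨h1, h2⟩)
    ⟨w, hw, hcon⟩ ⟨a, ha, Or.inr (hll ha hb h hne)⟩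
  have hvb : ll v b := by
    rcases hv with (hv | hv) | hv
    · exact absurd (M.le_of_ll _ _ hv) hv1
    · exact absurd (M.le_of_ll _ _ hv) hv2
    · exact hv
  have hsubset := hB.subset_left_of_subset_union ((hopen_ll v).inter (hopen_ll a))
    ((hopen_not_le v).union (hopen_not_le a))
    (disjoint_left.2 fun y hy hy' => hy'.elim (fun k => k (M.le_of_ll _ _ hy.1))
      (fun k => k (M.le_of_ll _ _ hy.2)))
    (fun y hy => by
      by_cases h1 : le v y
      · by_cases h2 : le a y
        · exact Or.inl ⟨hll hvB hy h1 (fun k => hv1 (k ▸ h2)), hll ha hy h2 fun k => hv2 (k ▸ h1)⟩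
        · exact Or.inr (Or.inr h2)
      · exact Or.inr (Or.inl h1))
    ⟨b, hb, hvb, hll ha hb h hne⟩
  exact M.irrefl _ (hsubset ha).2

/-- An invariant connected part of the Birkhoff center that contains two related points consists
of equilibria, any two of which are strongly related. -/
lemma fixed_and_ordered_of_le (M : IsCompetitiveFlow Φ le ll) [T2Space E]
    (hX : IsCompact (closure (recurrentPoints Φ))) {B : Set E} (hB : IsPreconnected B)
    (hBX : B ⊆ closure (recurrentPoints Φ)) (hinv : ∀ a ∈ B, orbitClosure Φ a ⊆ B) {a b : E}
    (ha : a ∈ B) (hb : b ∈ B) (h : le a b) (hne : a ≠ b) :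
    (∀ y ∈ B, ∀ t, Φ t y = y) ∧ ∀ y ∈ B, ∀ z ∈ B, y ≠ z → ll y z ∨ ll z y := by
  have hfix : ∀ y ∈ B, ∀ z ∈ B, (le y z ∨ le z y) → y ≠ z → ∀ t, Φ t y = y := by
    rintro y hy z hz (hyz | hyz) hyz'
    · exact M.fixed_of_le hX hB hBX hinv hy hz hyz hyz'
    · exact M.dual.fixed_of_le hX hB hBX hinv hy hz hyz hyz'
  have hcomp : ∀ y ∈ B, ∀ z ∈ B, (le y z ∨ le z y) → y ≠ z → ∀ w ∈ B, le y w ∨ le w y := by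
    rintro y hy z hz (hyz | hyz) hyz' w hw
    · exact M.comparable_of_le hX hB hBX hinv hy hz hyz hyz' hw
    · exact (M.dual.comparable_of_le hX hB hBX hinv hy hz hyz hyz' hw).symm
  have hrel : ∀ y ∈ B, ∃ z ∈ B, (le y z ∨ le z y) ∧ y ≠ z := fun y hy => by
    by_cases hya : y = a
    · exact ⟨b, hb, Or.inl (hya ▸ h), hya ▸ hne⟩
    · exact ⟨a, ha, (hcomp a ha b hb (Or.inl h) hne y hy).symm, hya⟩
  have hall : ∀ y ∈ B, ∀ t, Φ t y = y := fun y hy => by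
    obtain ⟨z, hz, hyz, hyz'⟩ := hrel y hy
    exact hfix y hy z hz hyz hyz'
  refine ⟨hall, fun y hy z hz hyz => ?_⟩
  obtain ⟨v, hv, hyv, hyv'⟩ := hrel y hy
  exact (hcomp y hy v hv hyv hyv' z hz).imp (fun k => M.ll_of_le (hall y hy) (hBX hz) k hyz)
    fun k => M.ll_of_le (hall z hz) (hBX hy) k hyz.symm

end IsCompetitiveFlow

lemma isCompetitiveFlow_of_stronglyCompetitive {n : ℕ} {Φ : ℝ → Euc n → Euc n} {Cp : Set (Euc n)}
    (hΦ : IsFlow Φ) (hC : IsConeOrder Cp) (hcomp : StronglyCompetitive Φ Cp)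
    [Nontrivial (Euc n)] :
    IsCompetitiveFlow Φ (coneLe Cp) (coneLL Cp) := by
  obtain ⟨hcl, hadd, hsmul, -, hsal⟩ := hC
  have h0 : (0 : Euc n) ∈ Cp := (hsal.symm.subset (mem_singleton 0)).1
  have hanti : ∀ v ∈ Cp, -v ∈ Cp → v = 0 := fun v hv hv' =>
    hsal.subset ⟨hv, mem_neg.2 hv'⟩
  exact
    { cont := hΦ.1
      zero := hΦ.2.1
      add := hΦ.2.2
      refl := fun x => by rw [coneLe, sub_self]; exact h0
      trans := fun x y z h h' => by
        have := hadd _ h _ h'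
        rwa [sub_add_sub_cancel'] at this
      antisymm := fun x y h h' => by
        refine (sub_eq_zero.1 (hanti _ h ?_)).symm
        rwa [neg_sub]
      le_of_ll := fun x y h => interior_subset h
      irrefl := fun x h => by
        rw [coneLL, sub_self, mem_interior_iff_mem_nhds] at h
        obtain ⟨v, hv⟩ := exists_ne (0 : Euc n)
        have htend : ∀ w : Euc n, ∀ᶠ c : ℝ in 𝓝[>] 0, c • w ∈ Cp := fun w => by
          have hc : Continuous fun c : ℝ => c • w := by fun_prop
          have := hc.tendsto 0
          rw [zero_smul] at this
          exact (this.mono_left nhdsWithin_le_nhds).eventually h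
        obtain ⟨c, ⟨h1, h2⟩, hc⟩ :=
          (((htend v).and (htend (-v))).and self_mem_nhdsWithin).exists
        rw [smul_neg] at h2
        exact (smul_ne_zero (ne_of_gt hc) hv) (hanti _ h1 h2)
      isClosed_le := hcl.preimage (continuous_snd.sub continuous_fst)
      isOpen_ll := isOpen_interior.preimage (continuous_snd.sub continuous_fst)
      strong := fun t ht x y h hne => by
        refine (hcomp (-t) (neg_pos.2 ht) (Φ t x) (Φ t y)).2 ?_
        simp only [hΦ.2.2, neg_add_cancel, hΦ.2.1]
        exact ⟨h, hne.symm⟩ }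

lemma recurrentSet_eq_recurrentPoints {n : ℕ} (Φ : ℝ → Euc n → Euc n) :
    recurrentSet Φ = recurrentPoints Φ := by
  ext x
  simp only [recurrentSet, omegaSet, recurrentPoints, mem_ofPred_eq, mem_iInter, mem_Ici,
    mem_closure_iff_nhds, mapClusterPt_iff_frequently, frequently_atTop]
  constructor
  · intro h U hU T
    obtain ⟨_, hy, τ, hτ, rfl⟩ := h (max T 0) (le_max_right _ _) U hU
    exact ⟨τ, (le_max_left _ _).trans hτ, hy⟩
  · intro h T _ U hU
    obtain ⟨τ, hτ, hy⟩ := h U hU T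
    exact ⟨_, hy, τ, hτ, rfl⟩

lemma isCompact_birkhoffCenter {n : ℕ} {Φ : ℝ → Euc n → Euc n} {Γ : Set (Euc n)}
    (hΓ : Dissipative Φ Γ) : IsCompact (birkhoffCenter Φ) := by
  obtain ⟨hne, hc, -, hatt⟩ := hΓ
  refine hc.of_isClosed_subset isClosed_closure (closure_minimal (fun r hr => ?_) hc.isClosed)
  rw [hc.isClosed.mem_iff_infDist_zero hne]
  refine le_antisymm (le_of_forall_pos_le_add fun ε hε => ?_) infDist_nonneg
  rw [zero_add]
  obtain ⟨T, hT⟩ := hatt {r} isCompact_singleton ε hε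
  rw [recurrentSet_eq_recurrentPoints] at hr
  by_contra! hlt
  have hopen : IsOpen {x | ε < infDist x Γ} := isOpen_lt continuous_const (continuous_infDist_pt Γ)
  obtain ⟨τ, hτ, hτU⟩ := IsCompetitiveFlow.exists_return hr (hopen.mem_nhds hlt) T
  exact lt_asymm hτU (hT τ hτ r rfl)

theorem stmt10 {n : ℕ} (Φ : ℝ → Euc n → Euc n) (Cp Γ : Set (Euc n))
    (hΦ : IsFlow Φ) (hC : IsConeOrder Cp) (hcomp : StronglyCompetitive Φ Cp)
    (hΓ : Dissipative Φ Γ)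
    (x : Euc n) (hx : x ∈ birkhoffCenter Φ) :
    Unordered Cp (connectedComponentIn (birkhoffCenter Φ) x) ∨
    (connectedComponentIn (birkhoffCenter Φ) x ⊆ equilibria Φ ∧
      ∀ a ∈ connectedComponentIn (birkhoffCenter Φ) x,
      ∀ b ∈ connectedComponentIn (birkhoffCenter Φ) x, a ≠ b →
        coneLL Cp a b ∨ coneLL Cp b a) := by
  set B := connectedComponentIn (birkhoffCenter Φ) x with hB
  by_cases hun : Unordered Cp B
  · exact Or.inl hun
  right
  simp only [Unordered, not_forall, not_not] at hun
  obtain ⟨a, ha, b, hb, hne, hab⟩ := hun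
  have : Nontrivial (Euc n) := ⟨a, b, hne⟩
  have M := isCompetitiveFlow_of_stronglyCompetitive hΦ hC hcomp
  have hBX : B ⊆ birkhoffCenter Φ := connectedComponentIn_subset _ _
  have hX := isCompact_birkhoffCenter hΓ
  have hcenter : birkhoffCenter Φ = closure (recurrentPoints Φ) := by
    rw [birkhoffCenter, recurrentSet_eq_recurrentPoints]
  have hinv : ∀ c ∈ B, orbitClosure Φ c ⊆ B := fun c hc => by
    rw [hB, connectedComponentIn_eq hc]
    refine (M.isPreconnected_orbitClosure c).subset_connectedComponentIn
      (M.self_mem_orbitClosure c) ?_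
    have := hBX hc
    rw [hcenter] at this ⊢
    exact M.orbitClosure_subset_center this
  rw [hcenter] at hBX hX
  exact M.fixed_and_ordered_of_le hX isPreconnected_connectedComponentIn hBX hinv ha hb hab hne
end
end
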